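/- For every n ∈ ℕ, H_{0,3}(3n) = 2·σ(n) − 6·δ_{3∣n}·∑_{d∣(n/3), d²<n/3} d − δ_{12n=□}·√(3n). -/

import Mathlib

open scoped BigOperators

namespace HurwitzPaper

/-- Evaluation of the binary quadratic form `(a,b,c)` (i.e. `a x² + b x y + c y²`). -/
def formEval (Q : ℤ × ℤ × ℤ) (x y : ℤ) : ℤ :=
  Q.1 * x ^ 2 + Q.2.1 * x * y + Q.2.2 * y ^ 2

/-- Discriminant `b² - 4ac` of the form `(a,b,c)`. -/
def formDisc (Q : ℤ × ℤ × ℤ) : ℤ := Q.2.1 ^ 2 - 4 * Q.1 * Q.2.2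

/-- Right action of `γ ∈ SL₂(ℤ)` on a binary quadratic form: `(Q∘γ)(x,y) = Q(ax+by, cx+dy)`. -/
def formAct (γ : Matrix.SpecialLinearGroup (Fin 2) ℤ) (Q : ℤ × ℤ × ℤ) : ℤ × ℤ × ℤ :=
  (formEval Q (γ.1 0 0) (γ.1 1 0),
   formEval Q (γ.1 0 0 + γ.1 0 1) (γ.1 1 0 + γ.1 1 1)
     - formEval Q (γ.1 0 0) (γ.1 1 0) - formEval Q (γ.1 0 1) (γ.1 1 1),
   formEval Q (γ.1 0 1) (γ.1 1 1))

/-- A form is positive definite iff its leading coefficient is positive and its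
discriminant is negative. -/
def IsPosDef (Q : ℤ × ℤ × ℤ) : Prop := 0 < Q.1 ∧ formDisc Q < 0

/-- `SL₂(ℤ)`-equivalence classes of positive definite integral binary quadratic forms
of discriminant `-N`. -/
abbrev FormClasses (N : ℤ) :=
  Quot (fun (Q Q' : {Q : ℤ × ℤ × ℤ // formDisc Q = -N ∧ IsPosDef Q}) =>
    ∃ γ : Matrix.SpecialLinearGroup (Fin 2) ℤ, formAct γ Q.1 = Q'.1)

/-- The Hurwitz class number `H(N)`: each class of positive definite forms of
discriminant `-N` is counted with weight `1/ω_Q = 2/#Γ_Q`, where `Γ_Q` is the stabilizer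
of (a representative of) the class in `SL₂(ℤ)`; `H(0) = -1/12`, and `H(N) = 0` when no
such forms exist (in particular for `N < 0` and `N ≡ 1, 2 (mod 4)`). -/
noncomputable def hurwitzClassNumber (N : ℤ) : ℝ :=
  if N = 0 then -(1 / 12)
  else ∑ᶠ c : FormClasses N,
    (2 : ℝ) / (Nat.card {γ : Matrix.SpecialLinearGroup (Fin 2) ℤ //
      formAct γ c.out.1 = c.out.1})

/-- `H_{κ,m,M}(n) = ∑_{t ≡ m (mod M)} t^κ H(4n - t²)`. -/
noncomputable def HH (κ : ℕ) (m : ℤ) (M : ℕ) (n : ℕ) : ℝ :=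
  ∑ᶠ t : ℤ, if t % (M : ℤ) = m % (M : ℤ) then
    (t : ℝ) ^ κ * hurwitzClassNumber (4 * n - t ^ 2) else 0

/-- `a(n)`: the `n`-th Fourier coefficient of `η(3τ)⁸ = q ∏_{k≥1} (1-q^{3k})⁸`
(the factors with `k > n` do not affect the coefficient of `q^n`). -/
noncomputable def etaCoeff (n : ℕ) : ℤ :=
  Polynomial.coeff (Polynomial.X * ∏ k ∈ Finset.Icc 1 n, (1 - Polynomial.X ^ (3 * k)) ^ 8 : Polynomial ℤ) n


section


abbrev SL := Matrix.SpecialLinearGroup (Fin 2) ℤ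

def sg (x : ℤ) : ℤ := Int.sign x

lemma sg_pos {x : ℤ} (h : 0 < x) : sg x = 1 := Int.sign_eq_one_of_pos h
lemma sg_neg' {x : ℤ} (h : x < 0) : sg x = -1 := Int.sign_eq_neg_one_of_neg h
lemma sg_zero : sg 0 = 0 := rfl
lemma sg_neg (x : ℤ) : sg (-x) = - sg x := Int.sign_neg x
lemma sg_mul (x y : ℤ) : sg (x * y) = sg x * sg y := Int.sign_mul x y
lemma sg_cases (x : ℤ) : (0 < x ∧ sg x = 1) ∨ (x = 0 ∧ sg x = 0) ∨ (x < 0 ∧ sg x = -1) := by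
  rcases lt_trichotomy x 0 with h | h | h
  · exact Or.inr (Or.inr ⟨h, sg_neg' h⟩)
  · exact Or.inr (Or.inl ⟨h, by rw [h]; rfl⟩)
  · exact Or.inl ⟨h, sg_pos h⟩

def tau (f : ℤ × ℤ × ℤ) : ℤ :=
  -2 - (sg f.1 + sg f.2.2) * sg f.2.1
    + (sg f.2.2 + sg (f.1 + f.2.1 + f.2.2)) * sg (2 * f.2.2 + f.2.1)
    + (sg f.1 + sg (f.1 + f.2.1 + f.2.2)) * sg (2 * f.1 + f.2.1)

set_option maxHeartbeats 2000000 in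
lemma tau_cases (p h l : ℤ) :
    (tau (p, h, l) = 4 ∧ ((0 < 2*p+h ∧ 0 < 2*l+h ∧ h < 0) ∨ (2*p+h < 0 ∧ 2*l+h < 0 ∧ 0 < h)))
  ∨ (tau (p, h, l) = 2 ∧ ((0 < 2*p+h ∧ 0 < 2*l+h ∧ h = 0) ∨ (2*p+h < 0 ∧ 2*l+h < 0 ∧ 0 = h)
    ∨ (0 < 2*p+h ∧ 0 = 2*l+h ∧ h < 0) ∨ (2*p+h < 0 ∧ 2*l+h = 0 ∧ 0 < h)
    ∨ (0 = 2*p+h ∧ 0 < 2*l+h ∧ h < 0) ∨ (2*p+h = 0 ∧ 2*l+h < 0 ∧ 0 < h)))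
  ∨ (tau (p, h, l) = -2 ∧ p = 0 ∧ h = 0 ∧ l = 0)
  ∨ (tau (p, h, l) = 0 ∧ ¬ (0 ≤ 2*p+h ∧ 0 ≤ 2*l+h ∧ h ≤ 0 ∧ (0 < 2*p+h ∨ 0 < 2*l+h) ∧ (0 < 2*p+h ∨ h < 0) ∧ (0 < 2*l+h ∨ h < 0))
    ∧ ¬ (2*p+h ≤ 0 ∧ 2*l+h ≤ 0 ∧ 0 ≤ h ∧ (2*p+h < 0 ∨ 2*l+h < 0) ∧ (2*p+h < 0 ∨ 0 < h) ∧ (2*l+h < 0 ∨ 0 < h)) ∧ ¬ (p = 0 ∧ h = 0 ∧ l = 0)) := by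
  simp only [tau]
  rcases sg_cases (2*p+h) with ⟨h1, e1⟩ | ⟨h1, e1⟩ | ⟨h1, e1⟩ <;>
  rcases sg_cases (2*l+h) with ⟨h2, e2⟩ | ⟨h2, e2⟩ | ⟨h2, e2⟩ <;>
  rcases sg_cases h with ⟨h3, e3⟩ | ⟨h3, e3⟩ | ⟨h3, e3⟩ <;>
  rcases sg_cases p with ⟨h4, e4⟩ | ⟨h4, e4⟩ | ⟨h4, e4⟩ <;> (try omega) <;>
  rcases sg_cases l with ⟨h5, e5⟩ | ⟨h5, e5⟩ | ⟨h5, e5⟩ <;> (try omega) <;>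
  rcases sg_cases (p+h+l) with ⟨h6, e6⟩ | ⟨h6, e6⟩ | ⟨h6, e6⟩ <;> (try omega) <;>
  rw [e1, e2, e3, e4, e5, e6] <;> norm_num <;> omega

lemma tau_neg (p h l : ℤ) : tau (-p, -h, -l) = tau (p, h, l) := by
  simp only [tau]
  rw [show -p + -h + -l = -(p+h+l) by ring, show 2 * -l + -h = -(2*l+h) by ring,
    show 2 * -p + -h = -(2*p+h) by ring]
  simp only [sg_neg]; ring

lemma tau_bound {p h l N : ℤ} (ht : tau (p, h, l) ≠ 0) (hd : formDisc (p, h, l) = -N) :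
    0 ≤ N ∧ |p| ≤ N ∧ |h| ≤ N ∧ |l| ≤ N := by
  simp only [formDisc] at hd
  have key : (2*p+h)*(2*l+h) + (2*p+h)*(-h) + (2*l+h)*(-h) = N := by linarith
  have main : ∀ P Q R : ℤ, P*Q+P*R+Q*R = N → 0 ≤ P → 0 ≤ Q → 0 ≤ R → (0 < P ∨ 0 < Q) → (0 < P ∨ 0 < R) →
     (0 < Q ∨ 0 < R) → 0 ≤ N ∧ P ≤ N ∧ Q ≤ N ∧ R ≤ N := by
    intro P Q R e hP hQ hR a b c
    have := mul_nonneg hP hQ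
    have := mul_nonneg hP hR
    have := mul_nonneg hQ hR
    refine ⟨by linarith, ?_, ?_, ?_⟩
    · rcases c with c | c <;> nlinarith
    · rcases b with c | c <;> nlinarith
    · rcases a with c | c <;> nlinarith
  have m1 := main (2*p+h) (2*l+h) (-h) key
  have m2 := main (-(2*p+h)) (-(2*l+h)) (h) (by linarith)
  simp only [abs_le]
  rcases tau_cases p h l with ⟨_, h1⟩ | ⟨_, h1⟩ | ⟨_, h1, h2, h3⟩ | ⟨h1, _⟩
  · rcases h1 with h1 | h1
    · have := m1 (by omega) (by omega) (by omega) (by omega) (by omega) (by omega); omega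
    · have := m2 (by omega) (by omega) (by omega) (by omega) (by omega) (by omega); omega
  · rcases h1 with h1 | h1 | h1 | h1 | h1 | h1
    · have := m1 (by omega) (by omega) (by omega) (by omega) (by omega) (by omega); omega
    · have := m2 (by omega) (by omega) (by omega) (by omega) (by omega) (by omega); omega
    · have := m1 (by omega) (by omega) (by omega) (by omega) (by omega) (by omega); omega
    · have := m2 (by omega) (by omega) (by omega) (by omega) (by omega) (by omega); omega
    · have := m1 (by omega) (by omega) (by omega) (by omega) (by omega) (by omega); omega
    · have := m2 (by omega) (by omega) (by omega) (by omega) (by omega) (by omega); omega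
  · subst h1 h2 h3; simp at hd; subst hd; simp
  · exact absurd h1 ht



end

section


lemma det_eq (γ : SL) : γ.1 0 0 * γ.1 1 1 - γ.1 0 1 * γ.1 1 0 = 1 := by
  have := γ.2; rwa [Matrix.det_fin_two] at this

lemma formAct_mul (γ δ : SL) (f : ℤ × ℤ × ℤ) : formAct (γ * δ) f = formAct δ (formAct γ f) := by
  simp only [formAct, formEval, Matrix.SpecialLinearGroup.coe_mul, Matrix.mul_apply, Fin.sum_univ_two,
    Prod.mk.injEq]
  refine ⟨by ring, by ring, by ring⟩

lemma formAct_one (f : ℤ × ℤ × ℤ) : formAct 1 f = f := by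
  obtain ⟨p, h, l⟩ := f
  simp [formAct, formEval]; ring

lemma formAct_inv (γ : SL) {f g : ℤ × ℤ × ℤ} (h : formAct γ f = g) : formAct γ⁻¹ g = f := by
  rw [← h, ← formAct_mul, mul_inv_cancel, formAct_one]

lemma formDisc_act (γ : SL) (f : ℤ × ℤ × ℤ) : formDisc (formAct γ f) = formDisc f := by
  have := det_eq γ
  have h2 : (γ.1 0 0 * γ.1 1 1 - γ.1 0 1 * γ.1 1 0)^2 = 1 := by rw [this]; norm_num
  have : formDisc (formAct γ f) = formDisc f * (γ.1 0 0 * γ.1 1 1 - γ.1 0 1 * γ.1 1 0)^2 := by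
    simp only [formDisc, formAct, formEval]; ring
  rw [this, h2, mul_one]

lemma formEval_pos {f : ℤ × ℤ × ℤ} (hf : IsPosDef f) {x y : ℤ} (h : x ≠ 0 ∨ y ≠ 0) : 0 < formEval f x y := by
  obtain ⟨p, b, l⟩ := f
  simp only [IsPosDef, formDisc] at hf
  simp only [formEval]
  obtain ⟨h1, h2⟩ := hf
  have e : 4 * p * (p * x^2 + b * x * y + l * y^2) = (2*p*x+b*y)^2 + (4*p*l-b^2) * y^2 := by ring
  have : 0 < (2*p*x+b*y)^2 + (4*p*l-b^2) * y^2 := by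
    by_cases hy : y = 0
    · subst hy
      have hx : x ≠ 0 := by simpa using h
      have : 0 < (2*p*x)^2 := by positivity
      simpa using this
    · have : 0 < (4*p*l-b^2) * y^2 := by
        apply mul_pos (by linarith); positivity
      nlinarith [sq_nonneg (2*p*x+b*y)]
  rw [← e] at this
  exact (mul_pos_iff_of_pos_left (by linarith)).1 this

lemma posDef_act (γ : SL) {f : ℤ × ℤ × ℤ} (hf : IsPosDef f) : IsPosDef (formAct γ f) := by
  refine ⟨?_, by rw [formDisc_act]; exact hf.2⟩
  apply formEval_pos hf
  have := det_eq γ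
  by_contra hc
  push Not at hc
  rw [hc.1, hc.2] at this; simp at this

abbrev XN (N : ℤ) := {Q : ℤ × ℤ × ℤ // formDisc Q = -N ∧ IsPosDef Q}

def xact {N : ℤ} (f : XN N) (γ : SL) : XN N :=
  ⟨formAct γ f.1, by rw [formDisc_act]; exact f.2.1, posDef_act γ f.2.2⟩

lemma mk_eq_iff {N : ℤ} (f g : XN N) :
    (Quot.mk _ f : FormClasses N) = Quot.mk _ g ↔ ∃ γ : SL, formAct γ f.1 = g.1 := by
  constructor
  · intro h
    have := Quot.eqvGen_exact h
    clear h
    induction this with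
    | rel _ _ h => exact h
    | refl x => exact ⟨1, formAct_one _⟩
    | symm _ _ _ ih => 
      obtain ⟨γ, h⟩ := ih; exact ⟨γ⁻¹, formAct_inv γ h⟩
    | trans _ _ _ _ _ ih1 ih2 => 
      obtain ⟨γ, h⟩ := ih1
      obtain ⟨δ, h'⟩ := ih2
      exact ⟨γ * δ, by rw [formAct_mul, h, h']⟩
  · intro h; exact Quot.sound h

def EE (f : ℤ × ℤ × ℤ) : ℤ := 2 * f.1 + 2 * f.2.2 + f.2.1

def Tri (f : ℤ × ℤ × ℤ) : Prop := 0 ≤ 2 * f.1 + f.2.1 ∧ 0 ≤ 2 * f.2.2 + f.2.1 ∧ f.2.1 ≤ 0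

lemma qpos {x y : ℤ} (h : ¬ (x = 0 ∧ y = 0)) : 1 ≤ x^2+x*y+y^2 := by
  have : 0 < 4 * (x^2+x*y+y^2) := by
    by_cases hy : y = 0
    · have : 0 < x^2 := by have : x ≠ 0 := fun hx => h ⟨hx, hy⟩
                           positivity
      subst hy; nlinarith
    · have : 0 < y^2 := by positivity
      nlinarith [sq_nonneg (2*x+y)]
  omega

lemma EE_act (γ : SL) (f : ℤ × ℤ × ℤ) : EE (formAct γ f) =
    (2 * f.1 + f.2.1) * ((γ.1 0 0)^2 + γ.1 0 0 * γ.1 0 1 + (γ.1 0 1)^2)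
    + (2 * f.2.2 + f.2.1) * ((γ.1 1 0)^2 + γ.1 1 0 * γ.1 1 1 + (γ.1 1 1)^2)
    + (-f.2.1) * ((γ.1 0 0 - γ.1 1 0)^2 + (γ.1 0 0 - γ.1 1 0) * (γ.1 0 1 - γ.1 1 1) + (γ.1 0 1 - γ.1 1 1)^2) := by
  simp only [EE, formAct, formEval]; ring

lemma rows_pos (γ : SL) : 1 ≤ (γ.1 0 0)^2 + γ.1 0 0 * γ.1 0 1 + (γ.1 0 1)^2 ∧
   1 ≤ (γ.1 1 0)^2 + γ.1 1 0 * γ.1 1 1 + (γ.1 1 1)^2 ∧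
   1 ≤ (γ.1 0 0 - γ.1 1 0)^2 + (γ.1 0 0 - γ.1 1 0) * (γ.1 0 1 - γ.1 1 1) + (γ.1 0 1 - γ.1 1 1)^2 := by
  have := det_eq γ
  refine ⟨qpos ?_, qpos ?_, qpos ?_⟩
  · rintro ⟨h1, h2⟩; rw [h1, h2] at this; simp at this
  · rintro ⟨h1, h2⟩; rw [h1, h2] at this; simp at this
  · rintro ⟨h1, h2⟩
    rw [sub_eq_zero.1 h1, sub_eq_zero.1 h2] at this; 
    have : (0:ℤ) = 1 := by rw [← this]; ring
    omega

lemma EE_le (γ : SL) {f : ℤ × ℤ × ℤ} (hf : Tri f) : EE f ≤ EE (formAct γ f) := by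
  obtain ⟨h1, h2, h3⟩ := rows_pos γ
  rw [EE_act]
  obtain ⟨a, b, c⟩ := hf
  have := mul_le_mul_of_nonneg_left h1 a
  have := mul_le_mul_of_nonneg_left h2 b
  have := mul_le_mul_of_nonneg_left h3 (neg_nonneg.2 c)
  simp only [EE]; linarith

def mkSL (a b c d : ℤ) (h : a * d - b * c = 1) : SL := ⟨!![a, b; c, d], by rw [Matrix.det_fin_two_of]; exact h⟩

def G12 : Finset SL := {mkSL 1 0 0 1 rfl, mkSL (-1) 0 0 (-1) rfl, mkSL 0 1 (-1) 0 rfl, mkSL 0 (-1) 1 0 rfl,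
  mkSL 1 0 (-1) 1 rfl, mkSL (-1) 0 1 (-1) rfl, mkSL 1 (-1) 0 1 rfl, mkSL (-1) 1 0 (-1) rfl,
  mkSL 1 (-1) 1 0 rfl, mkSL (-1) 1 (-1) 0 rfl, mkSL 0 1 (-1) 1 rfl, mkSL 0 (-1) 1 (-1) rfl}

lemma SL_ext' {γ δ : SL} (h1 : γ.1 0 0 = δ.1 0 0) (h2 : γ.1 0 1 = δ.1 0 1) (h3 : γ.1 1 0 = δ.1 1 0)
    (h4 : γ.1 1 1 = δ.1 1 1) : γ = δ := by
  apply Subtype.ext; ext i j; fin_cases i <;> fin_cases j <;> assumption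

lemma q_one {x y : ℤ} (h : x^2+x*y+y^2 = 1) : (x = 1 ∧ y = 0) ∨ (x = -1 ∧ y = 0) ∨ (x = 0 ∧ y = 1) ∨ (x = 0 ∧ y = -1)
    ∨ (x = 1 ∧ y = -1) ∨ (x = -1 ∧ y = 1) := by
  have h1 : -1 ≤ x := by nlinarith [sq_nonneg (x+2*y)]
  have h2 : x ≤ 1 := by nlinarith [sq_nonneg (x+2*y)]
  have h3 : -1 ≤ y := by nlinarith [sq_nonneg (y+2*x)]
  have h4 : y ≤ 1 := by nlinarith [sq_nonneg (y+2*x)]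
  interval_cases x <;> interval_cases y <;> simp_all

lemma mem_G12 (γ : SL) {f : ℤ × ℤ × ℤ} (hf : Tri f) (h1 : 0 < 2 * f.1 + f.2.1) (h2 : 0 < 2 * f.2.2 + f.2.1)
    (hg : Tri (formAct γ f)) : γ ∈ G12 := by
  have e1 : EE (formAct γ f) = EE f := by
    apply le_antisymm _ (EE_le γ hf)
    have := EE_le γ⁻¹ hg
    rwa [formAct_inv γ rfl] at this
  rw [EE_act] at e1
  obtain ⟨r1, r2, r3⟩ := rows_pos γ
  have := mul_le_mul_of_nonneg_left r1 h1.le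
  have := mul_le_mul_of_nonneg_left r2 h2.le
  have := mul_le_mul_of_nonneg_left r3 (neg_nonneg.2 hf.2.2)
  simp only [EE] at e1
  have n1 : (γ.1 0 0)^2 + γ.1 0 0 * γ.1 0 1 + (γ.1 0 1)^2 = 1 := by
    apply le_antisymm _ r1
    apply le_of_mul_le_mul_left _ h1
    linarith
  have n2 : (γ.1 1 0)^2 + γ.1 1 0 * γ.1 1 1 + (γ.1 1 1)^2 = 1 := by
    apply le_antisymm _ r2
    apply le_of_mul_le_mul_left _ h2
    linarith
  have d := det_eq γ
  simp only [G12, Finset.mem_insert, Finset.mem_singleton]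
  have key : ∀ a b c e (h : a * e - b * c = 1), γ.1 0 0 = a → γ.1 0 1 = b → γ.1 1 0 = c → γ.1 1 1 = e →
     γ = mkSL a b c e h := by
    intro a b c e h h1 h2 h3 h4
    exact SL_ext' h1 h2 h3 h4
  rcases q_one n1 with ⟨a, b⟩ | ⟨a, b⟩ | ⟨a, b⟩ | ⟨a, b⟩ | ⟨a, b⟩ | ⟨a, b⟩ <;>
  rcases q_one n2 with ⟨a', b'⟩ | ⟨a', b'⟩ | ⟨a', b'⟩ | ⟨a', b'⟩ | ⟨a', b'⟩ | ⟨a', b'⟩ <;>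
  rw [a, b, a', b'] at d <;> first | (exfalso; revert d; norm_num; done) | skip
  all_goals
    have := key _ _ _ _ (by norm_num) a b a' b'
    rw [this]; simp

lemma formAct_mk (a b c d h p q l) : formAct (mkSL a b c d h) (p, q, l) =
   (p * a^2 + q * a * c + l * c^2, 2 * p * a * b + q * (a * d + b * c) + 2 * l * c * d,
    p * b^2 + q * b * d + l * d^2) := by
  simp only [formAct, formEval, mkSL, Matrix.of_apply, Matrix.cons_val_zero, Matrix.cons_val_one, Prod.mk.injEq,
     Matrix.cons_val', Matrix.cons_val_fin_one]
  refine ⟨trivial, by ring, trivial⟩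



end

section


lemma sum_G12 (F : SL → ℤ) : ∑ γ ∈ G12, F γ = F (mkSL 1 0 0 1 rfl) + F (mkSL (-1) 0 0 (-1) rfl) + F (mkSL 0 1 (-1) 0 rfl) +
  F (mkSL 0 (-1) 1 0 rfl) +
  F (mkSL 1 0 (-1) 1 rfl) + F (mkSL (-1) 0 1 (-1) rfl) + F (mkSL 1 (-1) 0 1 rfl) + F (mkSL (-1) 1 0 (-1) rfl) +
  F (mkSL 1 (-1) 1 0 rfl) + F (mkSL (-1) 1 (-1) 0 rfl) + F (mkSL 0 1 (-1) 1 rfl) + F (mkSL 0 (-1) 1 (-1) rfl) := by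
  rw [G12]
  iterate 11 rw [Finset.sum_insert (by decide)]
  rw [Finset.sum_singleton]; ring

lemma tau_4 {p h l : ℤ} (H : 0 < 2*p+h ∧ 0 < 2*l+h ∧ h < 0) : tau (p, h, l) = 4 := by
  rcases tau_cases p h l with h1 | h1 | h1 | h1
  · exact h1.1
  all_goals (exfalso; omega)
lemma tau_2 {p h l : ℤ} (H : (0 < 2*p+h ∧ 0 < 2*l+h ∧ h = 0) ∨ (0 < 2*p+h ∧ 0 = 2*l+h ∧ h < 0)
   ∨ (0 = 2*p+h ∧ 0 < 2*l+h ∧ h < 0)) : tau (p, h, l) = 2 := by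
  rcases tau_cases p h l with h1 | h1 | h1 | h1
  · exfalso; omega
  · exact h1.1
  all_goals (exfalso; omega)
lemma tau_0 {p h l : ℤ} (H : (0 < 2*p+h ∨ 0 < 2*l+h ∨ h < 0) ∧ (2*p+h < 0 ∨ 2*l+h < 0 ∨ 0 < h)) :
    tau (p, h, l) = 0 := by
  rcases tau_cases p h l with h1 | h1 | h1 | h1
  · exfalso; omega
  · exfalso; omega
  · exfalso; omega
  · exact h1.1

lemma sum_G12_tau {f : ℤ × ℤ × ℤ} (hf : Tri f) (h1 : 0 < 2 * f.1 + f.2.1) (h2 : 0 < 2 * f.2.2 + f.2.1) :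
    ∑ γ ∈ G12, tau (formAct γ f) = 24 := by
  obtain ⟨p, h, l⟩ := f
  rw [sum_G12]
  simp only [formAct_mk]
  norm_num
  obtain ⟨_, _, h3⟩ := hf
  simp only at h1 h2 h3
  rcases h3.lt_or_eq with h3 | h3
  · rw [tau_4 (p := p) (h := h) (l := l) (by omega)]
    repeat (first | rw [tau_4 (by omega)] | rw [tau_0 (by omega)])
    norm_num
  · subst h3
    simp only [neg_zero, add_zero]
    iterate 12 (try rw [tau_2 (by omega)])
    norm_num

lemma exists_tri {N : ℤ} (f : XN N) : ∃ γ : SL, Tri (formAct γ f.1) := by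
  generalize hk : (EE f.1).toNat = k
  induction k using Nat.strong_induction_on generalizing f with
  | _ k ih =>
  by_cases ht : Tri f.1
  · exact ⟨1, by rwa [formAct_one]⟩
  · have step : ∃ γ : SL, EE (formAct γ f.1) < EE f.1 := by
      obtain ⟨⟨p, h, l⟩, hf⟩ := f
      simp only [Tri, not_and_or, not_le] at ht
      rcases ht with ht | ht | ht
      · exact ⟨mkSL 1 1 0 1 rfl, by rw [formAct_mk]; simp only [EE]; linarith⟩
      · exact ⟨mkSL 1 0 1 1 rfl, by rw [formAct_mk]; simp only [EE]; linarith⟩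
      · exact ⟨mkSL 0 (-1) 1 0 rfl, by rw [formAct_mk]; simp only [EE]; linarith⟩
    obtain ⟨γ, hγ⟩ := step
    have pos : ∀ g : XN N, 0 < EE g.1 := by
      intro g
      have a := formEval_pos g.2.2 (x := 1) (y := 0) (by simp)
      have b := formEval_pos g.2.2 (x := 0) (y := 1) (by simp)
      have c := formEval_pos g.2.2 (x := 1) (y := 1) (by simp)
      simp only [formEval] at a b c
      simp only [EE]; linarith
    have := pos f
    have h2 := pos (xact f γ)
    simp only [xact] at h2
    obtain ⟨δ, hδ⟩ := ih _ (by simp only [xact]; omega) (xact f γ) rfl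
    exact ⟨γ * δ, by rw [formAct_mul]; exact hδ⟩

lemma exists_tri' {N : ℤ} (f : XN N) : ∃ γ : SL, Tri (formAct γ f.1) ∧ 0 < 2 * (formAct γ f.1).1 + (formAct γ f.1).2.1
    ∧ 0 < 2 * (formAct γ f.1).2.2 + (formAct γ f.1).2.1 := by
  obtain ⟨γ, hγ⟩ := exists_tri f
  have h0 := (xact f γ).2.2
  have : ∃ δ : SL, Tri (formAct δ (formAct γ f.1)) ∧ 0 < 2 * (formAct δ (formAct γ f.1)).1 + (formAct δ (formAct γ f.1)).2.1
    ∧ 0 < 2 * (formAct δ (formAct γ f.1)).2.2 + (formAct δ (formAct γ f.1)).2.1 := by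
    simp only [xact] at h0
    generalize formAct γ f.1 = g at *
    obtain ⟨p, h, l⟩ := g
    simp only [Tri] at hγ
    simp only [IsPosDef, formDisc] at h0
    by_cases hP : 0 < 2*p+h
    · by_cases hQ : 0 < 2*l+h
      · exact ⟨1, by rw [formAct_one]; simp only [Tri]; omega⟩
      · refine ⟨mkSL 0 1 (-1) 1 rfl, ?_⟩
        rw [formAct_mk]; simp only [Tri]
        have : 2*l+h = 0 := by omega
        have : h ≠ 0 := by rintro rfl; have : l = 0 := by omega
                           subst this; simp at h0
        ring_nf; omega
    · refine ⟨mkSL 1 (-1) 1 0 rfl, ?_⟩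
      rw [formAct_mk]; simp only [Tri]
      have : 2*p+h = 0 := by omega
      have : h ≠ 0 := by omega
      have : 0 < 2*l+h := by
        rcases hγ.2.1.lt_or_eq with h1 | h1
        · exact h1
        · have : p = l := by omega
          subst this
          have : h = -2*p := by omega
          subst this; ring_nf at h0; omega
      ring_nf; omega
  obtain ⟨δ, hδ⟩ := this
  exact ⟨γ * δ, by rw [formAct_mul]; exact hδ⟩

lemma tau_tri {f : ℤ × ℤ × ℤ} (hf : IsPosDef f) (ht : tau f ≠ 0) : Tri f := by
  obtain ⟨p, h, l⟩ := f
  have := hf.1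
  simp only at this
  simp only [Tri]
  rcases tau_cases p h l with h1 | h1 | h1 | h1
  · omega
  · omega
  · omega
  · exact absurd h1.1 ht



end

section

open Classical in
lemma card_stab {N : ℤ} (c : FormClasses N) (f1 f : XN N) (h1 : Quot.mk _ f1 = c) (h : Quot.mk _ f = c) :
    Nat.card {γ : SL // formAct γ f1.1 = f.1} = Nat.card {γ : SL // formAct γ c.out.1 = c.out.1} := by
  obtain ⟨α, hα⟩ := (mk_eq_iff c.out f1).1 (by rw [h1]; exact Quot.out_eq c)
  obtain ⟨δ, hδ⟩ := (mk_eq_iff c.out f).1 (by rw [h]; exact Quot.out_eq c)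
  have hα' := formAct_inv α hα
  have hδ' := formAct_inv δ hδ
  refine Nat.card_congr ⟨fun γ => ⟨α * γ.1 * δ⁻¹, ?_⟩, fun γ => ⟨α⁻¹ * γ.1 * δ, ?_⟩, ?_, ?_⟩
  · rw [formAct_mul, formAct_mul, hα, γ.2, hδ']
  · rw [formAct_mul, formAct_mul, hα', γ.2, hδ]
  · intro γ; apply Subtype.ext; simp [mul_assoc]
  · intro γ; apply Subtype.ext; simp [mul_assoc]

lemma finite_box (N : ℤ) : {f : ℤ × ℤ × ℤ | tau f ≠ 0 ∧ formDisc f = -N}.Finite := by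
  apply Set.Finite.subset (Finset.finite_toSet (Finset.Icc (-N) N ×ˢ Finset.Icc (-N) N ×ˢ Finset.Icc (-N) N))
  rintro ⟨p, h, l⟩ ⟨h1, h2⟩
  have := tau_bound h1 h2
  simp only [abs_le] at this
  simp; omega

lemma finite_SN (N : ℤ) : {f : XN N | tau f.1 ≠ 0}.Finite := by
  apply Set.Finite.subset ((finite_box N).preimage (f := fun x : XN N => x.1) Subtype.val_injective.injOn)
  intro f hf
  exact ⟨hf, f.2.1⟩

noncomputable def SN (N : ℤ) : Finset (XN N) := (finite_SN N).toFinset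

open Classical in
lemma class_sum {N : ℤ} (c : FormClasses N) :
    (∑ f ∈ SN N with Quot.mk _ f = c, tau f.1) * (Nat.card {γ : SL // formAct γ c.out.1 = c.out.1} : ℤ) = 24 := by
  obtain ⟨α, hT, hP, hQ⟩ := exists_tri' c.out
  set f1 := xact c.out α with hf1
  have hc : Quot.mk _ f1 = c := by
    rw [← Quot.out_eq c]; symm; rw [mk_eq_iff]; exact ⟨α, rfl⟩
  have hmem : ∀ γ : SL, Quot.mk _ (xact f1 γ) = c := by
    intro γ; rw [← hc]; symm; rw [mk_eq_iff]; exact ⟨γ, rfl⟩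
  have s24 : ∑ γ ∈ G12, tau (formAct γ f1.1) = 24 := sum_G12_tau hT hP hQ
  rw [← Finset.sum_filter_ne_zero] at s24
  rw [← Finset.sum_fiberwise_of_maps_to (g := fun γ => xact f1 γ)
    (t := (SN N).filter (fun f => Quot.mk _ f = c))] at s24
  · rw [← s24, Finset.sum_mul]
    apply Finset.sum_congr rfl
    intro f hf
    rw [Finset.mem_filter, SN, Set.Finite.mem_toFinset] at hf
    obtain ⟨hf1', hf2⟩ := hf
    rw [← card_stab c f1 f hc hf2]
    rw [Finset.sum_congr rfl (g := fun _ => tau f.1)]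
    · rw [Finset.sum_const, nsmul_eq_mul, mul_comm]
      congr 2
      rw [← Nat.card_eq_finsetCard]
      apply Nat.card_congr
      apply Equiv.subtypeEquivRight
      intro γ
      rw [Finset.mem_filter, Finset.mem_filter]
      constructor
      · intro h
        have hne : tau (formAct γ f1.1) ≠ 0 := by rw [h]; exact hf1'
        exact ⟨⟨mem_G12 γ hT hP hQ (tau_tri (xact f1 γ).2.2 hne), hne⟩, Subtype.ext h⟩
      · intro h; rw [← h.2]; rfl
    · intro γ hγ
      rw [Finset.mem_filter] at hγ
      rw [← hγ.2]; rfl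
  · intro γ hγ
    rw [Finset.mem_filter] at hγ
    rw [Finset.mem_filter, SN, Set.Finite.mem_toFinset]
    exact ⟨hγ.2, hmem γ⟩

open Classical in
lemma sum_SN {N : ℤ} (hN : 0 < N) : (∑ f ∈ SN N, (tau f.1 : ℝ)) = 12 * hurwitzClassNumber N := by
  have key : ∀ c : FormClasses N, (∑ f ∈ SN N with Quot.mk _ f = c, (tau f.1 : ℝ)) =
      12 * ((2:ℝ) / Nat.card {γ : SL // formAct γ c.out.1 = c.out.1}) := by
    intro c
    have h := class_sum c
    have h' : (∑ f ∈ SN N with Quot.mk _ f = c, (tau f.1 : ℝ)) * (Nat.card {γ : SL // formAct γ c.out.1 = c.out.1} : ℝ) = 24 := by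
      exact_mod_cast h
    have hne : (Nat.card {γ : SL // formAct γ c.out.1 = c.out.1} : ℝ) ≠ 0 := by
      intro h0; rw [h0] at h'; norm_num at h'
    rw [← mul_div_assoc, eq_div_iff hne, h']; norm_num
  have hall : ∀ c : FormClasses N, c ∈ (SN N).image (fun f => (Quot.mk _ f : FormClasses N)) := by
    intro c
    by_contra hc
    have h := class_sum c
    rw [Finset.filter_false_of_mem] at h
    · simp at h
    · intro f hf h; exact hc (Finset.mem_image.2 ⟨f, hf, h⟩)
  rw [hurwitzClassNumber, if_neg hN.ne', finsum_eq_sum_of_support_subset (s := (SN N).image (fun f => (Quot.mk _ f : FormClasses N)))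
     _ (fun c _ => hall c), Finset.mul_sum, ← Finset.sum_congr rfl (fun c _ => key c)]
  exact (Finset.sum_fiberwise_of_maps_to (fun f hf => hall _) _).symm

def W (N : ℤ) (f : ℤ × ℤ × ℤ) : ℤ := if formDisc f = -N then tau f else 0

open Classical in
/-- Part I. -/
lemma sum_tau (N : ℤ) (B : Finset (ℤ × ℤ × ℤ)) (hB : ∀ f, formDisc f = -N → tau f ≠ 0 → f ∈ B) :
    ((∑ f ∈ B with formDisc f = -N, tau f : ℤ) : ℝ) = 24 * hurwitzClassNumber N := by
  have hB' : ∑ f ∈ B with formDisc f = -N, tau f = ∑ f ∈ (finite_box N).toFinset, tau f := by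
    symm
    apply Finset.sum_subset_zero_on_sdiff
    · intro f hf; simp at hf; simp; exact ⟨hB f hf.2 hf.1, hf.2⟩
    · intro f hf; simp at hf; by_contra h; exact hf.2 h hf.1.2
    · intros; rfl
  rw [hB']
  rcases lt_trichotomy N 0 with hN | hN | hN
  · have h0 : (finite_box N).toFinset = ∅ := by
      ext ⟨p, h, l⟩; simp
      intro h1 h2; have := tau_bound h1 h2; omega
    rw [h0, hurwitzClassNumber, if_neg hN.ne]
    have : IsEmpty (FormClasses N) := ⟨fun c => by
      have h := c.out.2
      have := h.2.2
      omega⟩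
    rw [finsum_of_isEmpty]; simp
  · subst hN
    have h0 : (finite_box 0).toFinset = {(0,0,0)} := by
      ext ⟨p, h, l⟩; simp
      constructor
      · rintro ⟨h1, h2⟩; have := tau_bound (N := 0) h1 (by rw [h2]; simp)
        simp at this; exact this
      · rintro ⟨rfl, rfl, rfl⟩; decide
    rw [h0, hurwitzClassNumber, if_pos rfl]
    have : tau (0,0,0) = -2 := by decide
    simp [this]; norm_num
  · have hpos : ∀ p h l, tau (p,h,l) ≠ 0 → formDisc (p,h,l) = -N → p ≠ 0 := by
      rintro p h l _ h2 rfl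
      simp [formDisc] at h2
      nlinarith [sq_nonneg h]
    rw [← Finset.sum_filter_add_sum_filter_not _ (fun f => 0 < f.1)]
    have e1 : ∑ f ∈ (finite_box N).toFinset with 0 < f.1, tau f = ∑ f ∈ SN N, tau f.1 := by
      symm
      apply Finset.sum_bij (fun f _ => f.1)
      · intro f hf; rw [SN, Set.Finite.mem_toFinset] at hf
        simp; exact ⟨⟨hf, f.2.1⟩, f.2.2.1⟩
      · intro a _ b _ h; exact Subtype.ext h
      · intro f hf; simp at hf
        exact ⟨⟨f, hf.1.2, hf.2, by rw [hf.1.2]; omega⟩, by rw [SN, Set.Finite.mem_toFinset]; exact hf.1.1, rfl⟩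
      · intros; rfl
    have e2 : ∑ f ∈ (finite_box N).toFinset with ¬ 0 < f.1, tau f =
        ∑ f ∈ (finite_box N).toFinset with 0 < f.1, tau f := by
      apply Finset.sum_nbij' (fun f => (-f.1, -f.2.1, -f.2.2)) (fun f => (-f.1, -f.2.1, -f.2.2))
      · rintro ⟨p, h, l⟩ hf; simp [tau_neg] at hf ⊢
        have := hpos _ _ _ hf.1.1 hf.1.2
        refine ⟨⟨hf.1.1, ?_⟩, by omega⟩
        rw [← hf.1.2]; simp [formDisc]
      · rintro ⟨p, h, l⟩ hf; simp [tau_neg] at hf ⊢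
        refine ⟨⟨hf.1.1, ?_⟩, by omega⟩
        rw [← hf.1.2]; simp [formDisc]
      · rintro ⟨p, h, l⟩ _; simp
      · rintro ⟨p, h, l⟩ _; simp
      · rintro ⟨p, h, l⟩ _; simp [tau_neg]
    rw [e2, e1]
    have := sum_SN hN
    push_cast
    rw [this]; ring



end

section


abbrev Q4 := ℤ × ℤ × ℤ × ℤ

lemma reidx (M : Finset Q4) (φ ψ : Q4 → Q4) (h1 : ∀ A ∈ M, φ A ∈ M) (h2 : ∀ A ∈ M, ψ A ∈ M)
    (l : ∀ A, ψ (φ A) = A) (r : ∀ A, φ (ψ A) = A) (F : Q4 → ℤ) : ∑ A ∈ M, F (φ A) = ∑ A ∈ M, F A :=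
  Finset.sum_nbij' φ ψ h1 h2 (fun A _ => l A) (fun A _ => r A) (fun _ _ => rfl)

def uu (k : ℤ) (A : Q4) : Q4 := (A.2.2.2 - A.2.1, k * A.1 + k * A.2.1 - A.2.2.1 - k * A.2.2.2, -A.2.1, A.1 + A.2.1)
def uv (k : ℤ) (A : Q4) : Q4 := (A.2.2.2 + A.2.2.1, -A.2.2.1, k * A.2.2.2 - k * A.1 + k * A.2.2.1 - A.2.1, A.1 - A.2.2.1)
def adj (A : Q4) : Q4 := (A.2.2.2, -A.2.1, -A.2.2.1, A.1)
def JJ (A : Q4) : Q4 := (A.2.2.2, A.2.2.1, A.2.1, A.1)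
def ng (A : Q4) : Q4 := (-A.1, -A.2.1, -A.2.2.1, -A.2.2.2)
def SS (A : Q4) : Q4 := (A.2.2.2, -A.2.2.1, -A.2.1, A.1)
def RR (A : Q4) : ℤ := (sg A.2.2.1 - sg A.2.1) * sg (A.1 - A.2.2.2)
def S2 (A : Q4) : ℤ := sg (A.1 * A.2.2.1) + sg (A.2.1 * A.2.2.2)
def G2 (A : Q4) : ℤ := sg (A.1 * A.2.2.1) + sg (A.2.2.1 * (A.2.2.1 - A.1))

lemma uvu (k : ℤ) (A : Q4) : uv k (uu k A) = A := by
  obtain ⟨a, b, c, d⟩ := A; simp only [uv, uu, Prod.mk.injEq]; refine ⟨by ring, by ring, by ring, by ring⟩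
lemma uuv (k : ℤ) (A : Q4) : uu k (uv k A) = A := by
  obtain ⟨a, b, c, d⟩ := A; simp only [uv, uu, Prod.mk.injEq]; refine ⟨by ring, by ring, by ring, by ring⟩
lemma adj2 (A : Q4) : adj (adj A) = A := by simp [adj]
lemma JJ2 (A : Q4) : JJ (JJ A) = A := by simp [JJ]
lemma ng2 (A : Q4) : ng (ng A) = A := by simp [ng]

lemma sum_S2 (k : ℤ) (M : Finset Q4) (hu : ∀ A ∈ M, uu k A ∈ M) (hv : ∀ A ∈ M, uv k A ∈ M) :
    ∑ A ∈ M, S2 A = ∑ A ∈ M, G2 A := by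
  simp only [S2, G2, Finset.sum_add_distrib]
  congr 1
  rw [← reidx M (uv k) (uu k) hv hu (uuv k) (uvu k)]
  apply Finset.sum_congr rfl
  intro A _
  simp only [uv]; congr 1; ring

def Ea (A : Q4) : ℤ := if A.1 = 0 then - (sg A.2.2.1 * sg A.2.2.2) else 0
def Ed (A : Q4) : ℤ := if A.2.2.2 = 0 then sg A.1 * sg A.2.2.1 else 0
def Eb (A : Q4) : ℤ := if A.2.1 = 0 then sg A.2.2.1 * (sg (A.1 - A.2.2.2) - sg A.1) else 0
def Ec (A : Q4) : ℤ := if A.2.2.1 = 0 then - sg A.2.1 * (sg (A.1 - A.2.2.2) + sg A.2.2.2) else 0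
def D1 (A : Q4) : ℤ := if 0 < A.2.1 * A.2.2.1 then -2 * (sg A.1 * sg A.2.2.1) else 0
def D2 (A : Q4) : ℤ := if A.2.1 * A.2.2.1 < 0 ∧ 0 < A.1 * A.2.2.2 then RR A else 0

lemma sg_sq {x : ℤ} : sg x = 1 ↔ 0 < x := by
  rcases sg_cases x with h | h | h <;> omega
lemma sg_eq_zero {x : ℤ} : sg x = 0 ↔ x = 0 := by
  rcases sg_cases x with h | h | h <;> omega
lemma sg_eq_neg {x : ℤ} : sg x = -1 ↔ x < 0 := by
  rcases sg_cases x with h | h | h <;> omega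

lemma pointwise {k n : ℤ} (hk : 0 < k) (hn : 0 < n) (a b c d : ℤ) (h : k * (a * d) - b * c = n) :
    RR (a,b,c,d) - S2 (a,b,c,d) = D1 (a,b,c,d) + D2 (a,b,c,d) + Ea (a,b,c,d) + Ed (a,b,c,d) + Eb (a,b,c,d) + Ec (a,b,c,d) := by
  have key : ¬ (a * d ≤ 0 ∧ 0 ≤ b * c) := by
    rintro ⟨h1, h2⟩
    have := mul_nonneg hk.le (neg_nonneg.2 h1)
    nlinarith
  have key' : ¬ (sg a * sg d ≤ 0 ∧ 0 ≤ sg b * sg c) := by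
    rw [← sg_mul, ← sg_mul]
    rcases sg_cases (a*d) with h | h | h <;> rcases sg_cases (b*c) with h' | h' | h' <;> omega
  clear key h
  simp only [RR, S2, D1, D2, Ea, Ed, Eb, Ec]
  simp only [← sg_sq, ← sg_eq_neg, sg_mul, ← sg_eq_zero (x := a), ← sg_eq_zero (x := b), ← sg_eq_zero (x := c), ← sg_eq_zero (x := d)]
  rcases sg_cases a with ⟨ha, ea⟩ | ⟨ha, ea⟩ | ⟨ha, ea⟩ <;>
  rcases sg_cases d with ⟨hd, ed⟩ | ⟨hd, ed⟩ | ⟨hd, ed⟩ <;>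
  rcases sg_cases b with ⟨hb, eb⟩ | ⟨hb, eb⟩ | ⟨hb, eb⟩ <;>
  rcases sg_cases c with ⟨hc, ec⟩ | ⟨hc, ec⟩ | ⟨hc, ec⟩ <;>
  rw [ea, eb, ec, ed] at key' ⊢ <;> 
  first | (exfalso; revert key'; norm_num; done) | skip
  all_goals first
    | (norm_num; done)
    | (rw [sg_pos (show 0 < a - d by omega)]; norm_num; done)
    | (rw [sg_neg' (show a - d < 0 by omega)]; norm_num; done)
    | (rw [show a - d = 0 by omega, sg_zero]; norm_num; done)
    | (norm_num; try ring)



end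

section


lemma sum_zero_of_neg {s : Finset Q4} {F : Q4 → ℤ} (φ : Q4 → Q4) (h1 : ∀ A ∈ s, φ A ∈ s)
    (h2 : ∀ A, φ (φ A) = A) (h : ∀ A ∈ s, F (φ A) = - F A) : ∑ A ∈ s, F A = 0 := by
  have := reidx s φ φ h1 h1 h2 h2 F
  rw [Finset.sum_congr rfl h, Finset.sum_neg_distrib] at this
  omega

lemma sum_D1 {k n : ℤ} (hk : 0 < k) (hn : 0 < n) {M : Finset Q4}
    (hM : ∀ a b c d, (a,b,c,d) ∈ M → k * (a * d) - b * c = n) (hadj : ∀ A ∈ M, adj A ∈ M) : ∑ A ∈ M, D1 A = 0 := by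
  apply sum_zero_of_neg adj hadj adj2
  rintro ⟨a, b, c, d⟩ hA
  have h := hM _ _ _ _ hA
  simp only [D1, adj]
  simp only [neg_mul_neg]
  split_ifs with hbc
  · have : 0 < a * d := by
      by_contra hc
      push Not at hc
      nlinarith [mul_nonneg hk.le (neg_nonneg.2 hc)]
    have : sg a * sg d = 1 := by rw [← sg_mul, sg_pos this]
    rw [sg_neg]
    have : sg a = sg d := by
      rcases sg_cases a with h | h | h <;> rcases sg_cases d with h' | h' | h' <;> simp_all
    rw [this]; ring
  · rfl

lemma sum_D2 {k n : ℤ} (hk : 0 < k) {M : Finset Q4}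
    (hM : ∀ a b c d, (a,b,c,d) ∈ M → k * (a * d) - b * c = n)
    (hsm : ∀ a b c d, k * (a * d) - b * c = n → |a| ≤ n → |b| ≤ n → |c| ≤ n → |d| ≤ n → (a,b,c,d) ∈ M) :
    ∑ A ∈ M, D2 A = 0 := by
  simp only [D2]
  rw [← Finset.sum_filter]
  apply sum_zero_of_neg SS
  · rintro ⟨a, b, c, d⟩ hA
    rw [Finset.mem_filter] at hA ⊢
    obtain ⟨hA, h1, h2⟩ := hA
    have h := hM _ _ _ _ hA
    simp only [SS] at h1 h2 ⊢
    have h3 : a * d ≤ k * (a * d) := by nlinarith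
    have hb : b ≠ 0 := by rintro rfl; simp at h1
    have hc : c ≠ 0 := by rintro rfl; simp at h1
    have ha : a ≠ 0 := by rintro rfl; simp at h2
    have hd : d ≠ 0 := by rintro rfl; simp at h2
    have e1 : |b| * |c| < n := by rw [← abs_mul, abs_of_neg h1]; linarith
    have e2 : |a| * |d| < n := by rw [← abs_mul, abs_of_pos h2]; linarith
    have := Int.one_le_abs ha
    have := Int.one_le_abs hb
    have := Int.one_le_abs hc
    have := Int.one_le_abs hd
    refine ⟨hsm _ _ _ _ (by linarith) ?_ ?_ ?_ ?_, by linarith, by linarith⟩ 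
    · nlinarith
    · rw [abs_neg]; nlinarith
    · rw [abs_neg]; nlinarith
    · nlinarith
  · intro A; simp [SS]
  · rintro ⟨a, b, c, d⟩ _
    simp only [RR, SS, sg_neg]
    rw [show d - a = -(a-d) by ring, sg_neg]; ring

lemma sum_sg_nonneg (hi : ℕ) : ∑ d ∈ Finset.Icc (0:ℤ) hi, sg d = hi := by
  induction hi with
  | zero => simp [sg_zero]
  | succ m ih =>
    have : Finset.Icc (0:ℤ) ((m+1 : ℕ):ℤ) = insert ((m+1:ℕ):ℤ) (Finset.Icc (0:ℤ) m) := by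
      ext x; simp; omega
    rw [this, Finset.sum_insert (by simp), ih, sg_pos (by positivity)]; push_cast; ring

lemma sum_sg {lo hi : ℤ} (h1 : lo ≤ 0) (h2 : 0 ≤ hi) : ∑ d ∈ Finset.Icc lo hi, sg d = lo + hi := by
  obtain ⟨m, rfl⟩ := Int.eq_ofNat_of_zero_le h2
  obtain ⟨j, hj⟩ := Int.eq_ofNat_of_zero_le (neg_nonneg.2 h1)
  have e : lo = -(j:ℤ) := by omega
  subst e
  clear hj h1 h2
  induction j with
  | zero => simpa using sum_sg_nonneg m
  | succ j ih =>
    have : Finset.Icc (-((j+1 : ℕ):ℤ)) m = insert (-((j+1:ℕ):ℤ)) (Finset.Icc (-(j:ℤ)) m) := by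
      ext x; simp; omega
    rw [this, Finset.sum_insert (by simp), ih, sg_neg' (by push_cast; omega)]; push_cast; ring

/-- pairs of positive integers with `k a d = n`. -/
noncomputable def PP (k n : ℤ) : Finset (ℤ × ℤ) := (Finset.Icc 1 n ×ˢ Finset.Icc 1 n).filter (fun x => k * (x.1 * x.2) = n)

lemma mem_PP {k n : ℤ} (hk : 0 < k) (x : ℤ × ℤ) : x ∈ PP k n ↔ 0 < x.1 ∧ 0 < x.2 ∧ k * (x.1 * x.2) = n := by
  simp only [PP, Finset.mem_filter, Finset.mem_product, Finset.mem_Icc]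
  constructor
  · rintro ⟨h, e⟩; omega
  · rintro ⟨h1, h2, e⟩
    have := mul_pos h1 h2
    refine ⟨⟨⟨by omega, by nlinarith⟩, by omega, by nlinarith⟩, e⟩

lemma half {M : Finset Q4} (hng : ∀ A ∈ M, ng A ∈ M) (F : Q4 → ℤ) (hF : ∀ A, F (ng A) = F A) (χ : Q4 → ℤ)
    (hχ : ∀ A, χ (ng A) = - χ A) (h0 : ∀ A ∈ M, χ A = 0 → F A = 0) :
    ∑ A ∈ M, F A = 2 * ∑ A ∈ M with 0 < χ A, F A := by
  have h1 : ∑ A ∈ M, F A = ∑ A ∈ M, (if 0 < χ A then F A else 0) + ∑ A ∈ M, (if 0 < χ (ng A) then F (ng A) else 0) := by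
    rw [← Finset.sum_add_distrib]
    apply Finset.sum_congr rfl
    intro A hA
    rw [hF, hχ]
    rcases lt_trichotomy (χ A) 0 with h | h | h
    · rw [if_neg (by omega), if_pos (by omega)]; simp
    · rw [if_neg (by omega), if_neg (by omega), h0 A hA h]; simp
    · rw [if_pos (by omega), if_neg (by omega)]; simp
  rw [h1, reidx M ng ng hng hng ng2 ng2 (fun A => if 0 < χ A then F A else 0), Finset.sum_filter]
  ring

lemma sum_Ea {k n : ℤ} (hn : 0 < n) {M : Finset Q4}
    (hM : ∀ a b c d, (a,b,c,d) ∈ M → k * (a * d) - b * c = n) (hng : ∀ A ∈ M, ng A ∈ M)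
    (hw : ∀ β γ, 0 < β → 0 < γ → β * γ = n → ∃ lo hi, lo ≤ 0 ∧ 0 ≤ hi ∧ lo + hi = -(β+γ) ∧
      ∀ d, (0,-β,γ,d) ∈ M ↔ lo ≤ d ∧ d ≤ hi) :
    ∑ A ∈ M, Ea A = 2 * ∑ x ∈ PP 1 n, (x.1 + x.2) := by
  rw [half hng Ea (by intro A; simp only [Ea, ng, sg_neg, neg_eq_zero]; congr 2; ring) (fun A => A.2.2.1)
    (by intro A; rfl) (by intro A _ h; simp only [Ea]; rw [h, sg_zero]; simp)]
  congr 1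
  simp only [Ea]
  rw [← Finset.sum_filter, Finset.filter_filter]
  rw [← Finset.sum_fiberwise_of_maps_to (g := fun A => ((-A.2.1, A.2.2.1) : ℤ × ℤ)) (t := PP 1 n)]
  · apply Finset.sum_congr rfl
    rintro ⟨β, γ⟩ hx
    rw [mem_PP one_pos] at hx
    obtain ⟨lo, hi, h1, h2, h3, h4⟩ := hw β γ hx.1 hx.2.1 (by linarith [hx.2.2])
    have e := sum_sg h1 h2
    rw [h3] at e
    have : ∑ d ∈ Finset.Icc lo hi, -(sg d) = β + γ := by rw [Finset.sum_neg_distrib, e]; ring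
    rw [← this]
    symm
    apply Finset.sum_bij (fun d _ => ((0, -β, γ, d) : Q4))
    · intro d hd
      simp only [Finset.mem_filter, h4, neg_neg, and_true]
      rw [Finset.mem_Icc] at hd
      exact ⟨hd, hx.2.1⟩
    · intro d _ d' _ h; simpa using h
    · rintro ⟨a, b, c, d⟩ hA
      simp only [Finset.mem_filter, Prod.mk.injEq] at hA
      obtain ⟨⟨hA, hc, rfl⟩, rfl, rfl⟩ := hA
      refine ⟨d, ?_, by simp⟩
      rw [Finset.mem_Icc, ← h4]; simpa using hA
    · intro d _
      simp only
      rw [sg_pos hx.2.1]; ring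
  · rintro ⟨a, b, c, d⟩ hA
    rw [Finset.mem_filter] at hA
    obtain ⟨hA, hc, ha⟩ := hA
    simp only at hc ha
    have h := hM _ _ _ _ hA
    subst ha
    rw [mem_PP one_pos]
    simp only
    refine ⟨?_, hc, by linarith⟩
    nlinarith

lemma sum_Eb {k n : ℤ} (hk : 0 < k) (hn : 0 < n) {M : Finset Q4}
    (hM : ∀ a b c d, (a,b,c,d) ∈ M → k * (a * d) - b * c = n) (hng : ∀ A ∈ M, ng A ∈ M)
    (hw : ∀ a d, 0 < a → a ≤ d → k * (a * d) = n → ∃ lo hi, lo ≤ 0 ∧ 0 ≤ hi ∧ lo + hi = -(k*(d-a)) ∧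
      ∀ c, (a,0,c,d) ∈ M ↔ lo ≤ c ∧ c ≤ hi) :
    ∑ A ∈ M, Eb A = 4 * k * ∑ x ∈ PP k n with x.1 < x.2, (x.2 - x.1) := by
  rw [half hng Eb (by
      intro A; simp only [Eb, ng, sg_neg, neg_eq_zero]
      rw [show -A.1 - -A.2.2.2 = -(A.1 - A.2.2.2) by ring, sg_neg]; congr 1; ring) (fun A => A.1)
    (by intro A; rfl) (by 
      rintro ⟨a,b,c,d⟩ hA h; simp only at h; subst h; simp only [Eb]
      have := hM _ _ _ _ hA
      split_ifs with hb
      · subst hb; simp at this; omega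
      · rfl)]
  rw [show 4 * k * ∑ x ∈ PP k n with x.1 < x.2, (x.2 - x.1) = 2 * ∑ x ∈ PP k n with x.1 < x.2, 2 * k * (x.2 - x.1) by
    rw [← Finset.mul_sum]; ring]
  congr 1
  rw [Finset.sum_filter (s := PP k n)]
  simp only [Eb]
  rw [← Finset.sum_filter, Finset.filter_filter]
  rw [← Finset.sum_fiberwise_of_maps_to (g := fun A => ((A.1, A.2.2.2) : ℤ × ℤ)) (t := PP k n)]
  · apply Finset.sum_congr rfl
    rintro ⟨a, d⟩ hx
    rw [mem_PP hk] at hx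
    simp only at hx ⊢
    rcases lt_or_ge d a with hda | hda
    · rw [if_neg (by omega)]
      apply Finset.sum_eq_zero
      rintro ⟨a', b, c, d'⟩ hA
      simp only [Finset.mem_filter, Prod.mk.injEq] at hA
      obtain ⟨_, rfl, rfl⟩ := hA
      simp only
      rw [sg_pos hx.1, sg_pos (show 0 < a' - d' by omega)]; ring
    obtain ⟨lo, hi, h1, h2, h3, h4⟩ := hw a d hx.1 hda hx.2.2
    have e := sum_sg h1 h2
    rw [h3] at e
    have : ∑ c ∈ Finset.Icc lo hi, (sg c) * (sg (a - d) - sg a) = if a < d then 2 * k * (d - a) else 0 := by 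
      rw [← Finset.sum_mul, e, sg_pos hx.1]
      split_ifs with h
      · rw [sg_neg' (by omega)]; ring
      · have : a = d := by omega
        subst this; ring
    rw [← this]
    symm
    apply Finset.sum_bij (fun c _ => ((a, 0, c, d) : Q4))
    · intro d hd
      simp only [Finset.mem_filter, h4, and_true]
      rw [Finset.mem_Icc] at hd
      exact ⟨hd, hx.1⟩
    · intro d _ d' _ h; simpa using h
    · rintro ⟨a, b, c, d⟩ hA
      simp only [Finset.mem_filter, Prod.mk.injEq] at hA
      obtain ⟨⟨hA, hc, rfl⟩, rfl, rfl⟩ := hA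
      refine ⟨c, ?_, by simp⟩
      rw [Finset.mem_Icc, ← h4]; simpa using hA
    · intro d _; rfl
  · rintro ⟨a, b, c, d⟩ hA
    rw [Finset.mem_filter] at hA
    obtain ⟨hA, ha, hb⟩ := hA
    simp only at hb ha
    have h := hM _ _ _ _ hA
    subst hb
    rw [mem_PP hk]
    simp only
    refine ⟨ha, ?_, by linarith⟩
    have : 0 < k * a * d := by nlinarith
    exact (mul_pos_iff_of_pos_left (mul_pos hk ha)).1 this

lemma core {k n : ℤ} (hk : 0 < k) (hn : 0 < n) {M : Finset Q4}
    (hM : ∀ a b c d, (a,b,c,d) ∈ M → k * (a * d) - b * c = n) (hng : ∀ A ∈ M, ng A ∈ M)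
    (hadj : ∀ A ∈ M, adj A ∈ M) (hJ : ∀ A ∈ M, JJ A ∈ M)
    (hsm : ∀ a b c d, k * (a * d) - b * c = n → |a| ≤ n → |b| ≤ n → |c| ≤ n → |d| ≤ n → (a,b,c,d) ∈ M)
    (hw : ∀ β γ, 0 < β → 0 < γ → β * γ = n → ∃ lo hi, lo ≤ 0 ∧ 0 ≤ hi ∧ lo + hi = -(β+γ) ∧
      ∀ d, (0,-β,γ,d) ∈ M ↔ lo ≤ d ∧ d ≤ hi)
    (hw' : ∀ a d, 0 < a → a ≤ d → k * (a * d) = n → ∃ lo hi, lo ≤ 0 ∧ 0 ≤ hi ∧ lo + hi = -(k*(d-a)) ∧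
      ∀ c, (a,0,c,d) ∈ M ↔ lo ≤ c ∧ c ≤ hi) :
    ∑ A ∈ M, RR A - ∑ A ∈ M, S2 A = 4 * ∑ x ∈ PP 1 n, (x.1 + x.2) + 8 * k * ∑ x ∈ PP k n with x.1 < x.2, (x.2 - x.1) := by
  rw [← Finset.sum_sub_distrib]
  rw [Finset.sum_congr rfl (g := fun A => D1 A + D2 A + Ea A + Ed A + Eb A + Ec A)
    (fun A hA => pointwise hk hn A.1 A.2.1 A.2.2.1 A.2.2.2 (hM _ _ _ _ hA))]
  simp only [Finset.sum_add_distrib]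
  rw [sum_D1 hk hn hM hadj, sum_D2 hk hM hsm]
  have e1 : ∑ A ∈ M, Ed A = ∑ A ∈ M, Ea A := by
    rw [← reidx M adj adj hadj hadj adj2 adj2]
    apply Finset.sum_congr rfl
    intro A _
    simp only [Ed, Ea, adj, sg_neg]; congr 1; ring
  have e2 : ∑ A ∈ M, Ec A = ∑ A ∈ M, Eb A := by
    rw [← reidx M JJ JJ hJ hJ JJ2 JJ2]
    apply Finset.sum_congr rfl
    intro A _
    simp only [Ec, Eb, JJ]
    rw [show A.2.2.2 - A.1 = -(A.1 - A.2.2.2) by ring, sg_neg]; congr 1; ring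
  rw [e1, e2, sum_Ea hn hM hng hw, sum_Eb hk hn hM hng hw', Finset.sum_add_distrib]
  ring



end

section


def bd (X x : ℤ) : Prop := -X ≤ x ∧ x ≤ X
instance (X x : ℤ) : Decidable (bd X x) := by unfold bd; infer_instance

def C1 (n X : ℤ) (A : Q4) : Prop := 1 * (A.1 * A.2.2.2) - A.2.1 * A.2.2.1 = n ∧ 
  bd X A.1 ∧ bd X A.2.1 ∧ bd X A.2.2.1 ∧ bd X A.2.2.2 ∧ bd X (A.1 + A.2.1) ∧ bd X (A.2.2.1 + A.2.2.2) ∧ bd X (A.1 - A.2.2.1)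
  ∧ bd X (A.2.1 - A.2.2.2) ∧ bd X (A.1 + A.2.1 - A.2.2.1 - A.2.2.2)

def C3 (n X : ℤ) (A : Q4) : Prop := 3 * (A.1 * A.2.2.2) - A.2.1 * A.2.2.1 = n ∧ 
  bd X (A.2.2.2) ∧ bd X (A.2.2.1 + A.2.2.2) ∧ bd X (A.2.2.1 + 2 * A.2.2.2) ∧ bd X (A.2.1 - 2 * A.2.2.2) ∧ bd X (A.2.1 - A.2.2.2)
  ∧ bd X (A.1 - A.2.2.1) ∧ bd X A.1 ∧ bd X (A.1 + A.2.1 - A.2.2.1 - 3 * A.2.2.2) ∧ bd X (A.1 + A.2.1)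
  ∧ bd X (2 * A.1 - A.2.2.1) ∧ bd X (2 * A.1 + A.2.1 - 2 * A.2.2.1 - 3 * A.2.2.2) ∧ bd X (2 * A.1 + A.2.1)
  ∧ bd X (2 * A.1 + 2 * A.2.1 - A.2.2.1 - 3 * A.2.2.2) ∧ bd X (3 * A.1 + A.2.1 - 2 * A.2.2.1 - 2 * A.2.2.2)
  ∧ bd X (3 * A.1 + A.2.1 - A.2.2.1 - A.2.2.2) ∧ bd X (3 * A.1 + 2 * A.2.1 - 2 * A.2.2.1 - 4 * A.2.2.2)
  ∧ bd X (3 * A.1 + 2 * A.2.1 - A.2.2.1 - 2 * A.2.2.2) ∧ bd X (4 * A.1 + 2 * A.2.1 - 2 * A.2.2.1 - 3 * A.2.2.2)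

noncomputable def bx (X : ℤ) : Finset Q4 :=
  Finset.Icc (-X) X ×ˢ Finset.Icc (-X) X ×ˢ Finset.Icc (-X) X ×ˢ Finset.Icc (-X) X

open Classical in
noncomputable def M1 (n X : ℤ) : Finset Q4 := (bx X).filter (C1 n X)
open Classical in
noncomputable def M3 (n X : ℤ) : Finset Q4 := (bx (2 * X)).filter (C3 n X)

lemma mem_M1 {n X : ℤ} (A : Q4) : A ∈ M1 n X ↔ C1 n X A := by
  simp only [M1, Finset.mem_filter, bx, Finset.mem_product, Finset.mem_Icc, and_iff_right_iff_imp]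
  intro h; simp only [C1, bd] at h; omega

lemma mem_M3 {n X : ℤ} (A : Q4) : A ∈ M3 n X ↔ C3 n X A := by
  simp only [M3, Finset.mem_filter, bx, Finset.mem_product, Finset.mem_Icc, and_iff_right_iff_imp]
  intro h; simp only [C3, bd] at h; omega

def l1 (A : Q4) : Q4 := (A.1 - A.2.2.1, A.2.1 - A.2.2.2, A.1, A.2.1)
def l1' (A : Q4) : Q4 := (A.2.2.1, A.2.2.2, A.2.2.1 - A.1, A.2.2.2 - A.2.1)
def l3 (A : Q4) : Q4 := (2 * A.1 - A.2.2.1, 2 * A.2.1 - 3 * A.2.2.2, 3 * A.1 - A.2.2.1, A.2.1 - A.2.2.2)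
def l3' (A : Q4) : Q4 := (-A.1 + A.2.2.1, -A.2.1 + 3 * A.2.2.2, -3 * A.1 + 2 * A.2.2.1, -A.2.1 + 2 * A.2.2.2)

lemma M1_ng {n X} : ∀ A ∈ M1 n X, ng A ∈ M1 n X := by
  rintro ⟨a, b, c, d⟩; simp only [mem_M1, C1, ng, bd]; rintro ⟨h, h'⟩; refine ⟨by rw [← h]; ring, ?_⟩; omega
lemma M1_adj {n X} : ∀ A ∈ M1 n X, adj A ∈ M1 n X := by
  rintro ⟨a, b, c, d⟩; simp only [mem_M1, C1, adj, bd]; rintro ⟨h, h'⟩; refine ⟨by rw [← h]; ring, ?_⟩; omega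
lemma M1_JJ {n X} : ∀ A ∈ M1 n X, JJ A ∈ M1 n X := by
  rintro ⟨a, b, c, d⟩; simp only [mem_M1, C1, JJ, bd]; rintro ⟨h, h'⟩; refine ⟨by rw [← h]; ring, ?_⟩; omega
lemma M1_uu {n X} : ∀ A ∈ M1 n X, uu 1 A ∈ M1 n X := by
  rintro ⟨a, b, c, d⟩; simp only [mem_M1, C1, uu, bd]; rintro ⟨h, h'⟩; refine ⟨by rw [← h]; ring, ?_⟩; omega
lemma M1_uv {n X} : ∀ A ∈ M1 n X, uv 1 A ∈ M1 n X := by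
  rintro ⟨a, b, c, d⟩; simp only [mem_M1, C1, uv, bd]; rintro ⟨h, h'⟩; refine ⟨by rw [← h]; ring, ?_⟩; omega
lemma M1_l {n X} : ∀ A ∈ M1 n X, l1 A ∈ M1 n X := by
  rintro ⟨a, b, c, d⟩; simp only [mem_M1, C1, l1, bd]; rintro ⟨h, h'⟩; refine ⟨by rw [← h]; ring, ?_⟩; omega
lemma M1_l' {n X} : ∀ A ∈ M1 n X, l1' A ∈ M1 n X := by
  rintro ⟨a, b, c, d⟩; simp only [mem_M1, C1, l1', bd]; rintro ⟨h, h'⟩; refine ⟨by rw [← h]; ring, ?_⟩; omega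

lemma M3_ng {n X} : ∀ A ∈ M3 n X, ng A ∈ M3 n X := by
  rintro ⟨a, b, c, d⟩; simp only [mem_M3, C3, ng, bd]; rintro ⟨h, h'⟩; refine ⟨by rw [← h]; ring, ?_⟩; omega
lemma M3_adj {n X} : ∀ A ∈ M3 n X, adj A ∈ M3 n X := by
  rintro ⟨a, b, c, d⟩; simp only [mem_M3, C3, adj, bd]; rintro ⟨h, h'⟩; refine ⟨by rw [← h]; ring, ?_⟩; omega
lemma M3_JJ {n X} : ∀ A ∈ M3 n X, JJ A ∈ M3 n X := by
  rintro ⟨a, b, c, d⟩; simp only [mem_M3, C3, JJ, bd]; rintro ⟨h, h'⟩; refine ⟨by rw [← h]; ring, ?_⟩; omega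
lemma M3_uu {n X} : ∀ A ∈ M3 n X, uu 3 A ∈ M3 n X := by
  rintro ⟨a, b, c, d⟩; simp only [mem_M3, C3, uu, bd]; rintro ⟨h, h'⟩; refine ⟨by rw [← h]; ring, ?_⟩; omega
lemma M3_uv {n X} : ∀ A ∈ M3 n X, uv 3 A ∈ M3 n X := by
  rintro ⟨a, b, c, d⟩; simp only [mem_M3, C3, uv, bd]; rintro ⟨h, h'⟩; refine ⟨by rw [← h]; ring, ?_⟩; omega
lemma M3_l {n X} : ∀ A ∈ M3 n X, l3 A ∈ M3 n X := by
  rintro ⟨a, b, c, d⟩; simp only [mem_M3, C3, l3, bd]; rintro ⟨h, h'⟩; refine ⟨by rw [← h]; ring, ?_⟩; omega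
lemma M3_l' {n X} : ∀ A ∈ M3 n X, l3' A ∈ M3 n X := by
  rintro ⟨a, b, c, d⟩; simp only [mem_M3, C3, l3', bd]; rintro ⟨h, h'⟩; refine ⟨by rw [← h]; ring, ?_⟩; omega

lemma G2_sum1 {a b c d : ℤ} (h : ¬ (a = 0 ∧ c = 0)) :
    G2 (a,b,c,d) + G2 (l1 (a,b,c,d)) + G2 (l1 (l1 (a,b,c,d))) = 2 := by
  simp only [G2, l1, sg_mul]
  rw [show a - c - a = -c by ring, show a - (a - c) = c by ring, show a - c - -c = a by ring, 
    show c - a = -(a-c) by ring]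
  simp only [sg_neg]
  rcases sg_cases a with ⟨ha, ea⟩ | ⟨ha, ea⟩ | ⟨ha, ea⟩ <;>
  rcases sg_cases c with ⟨hd, ed⟩ | ⟨hd, ed⟩ | ⟨hd, ed⟩ <;>
  rcases sg_cases (a-c) with ⟨hb, eb⟩ | ⟨hb, eb⟩ | ⟨hb, eb⟩ <;> (try omega) <;> rw [ea, eb, ed] <;> norm_num

lemma G2_sum3 {a b c d : ℤ} (h : ¬ (a = 0 ∧ c = 0)) :
    G2 (a,b,c,d) + G2 (l3 (a,b,c,d)) + G2 (l3 (l3 (a,b,c,d))) = 4 := by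
  simp only [G2, l3, sg_mul]
  rw [show 3 * a - c - (2 * a - c) = a by ring, show 2 * (2 * a - c) - (3 * a - c) = a - c by ring,
    show 3 * (2 * a - c) - (3 * a - c) = 3 * a - 2 * c by ring, show 3 * a - 2 * c - (a - c) = 2 * a - c by ring,
    show c - a = -(a-c) by ring]
  simp only [sg_neg]
  rcases sg_cases a with ⟨ha, ea⟩ | ⟨ha, ea⟩ | ⟨ha, ea⟩ <;>
  rcases sg_cases c with ⟨hd, ed⟩ | ⟨hd, ed⟩ | ⟨hd, ed⟩ <;>
  rcases sg_cases (a-c) with ⟨hb, eb⟩ | ⟨hb, eb⟩ | ⟨hb, eb⟩ <;> (try omega) <;> 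
  rcases sg_cases (2*a-c) with ⟨h1, e1⟩ | ⟨h1, e1⟩ | ⟨h1, e1⟩ <;> (try omega) <;> 
  rcases sg_cases (3*a-c) with ⟨h2, e2⟩ | ⟨h2, e2⟩ | ⟨h2, e2⟩ <;> (try omega) <;> 
  rcases sg_cases (3*a-2*c) with ⟨h3, e3⟩ | ⟨h3, e3⟩ | ⟨h3, e3⟩ <;> (try omega) <;> 
  rw [ea, eb, ed, e1, e2, e3] <;> norm_num

lemma sum_G2 {M : Finset Q4} {l l' : Q4 → Q4} (h1 : ∀ A ∈ M, l A ∈ M) (h2 : ∀ A ∈ M, l' A ∈ M)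
    (e1 : ∀ A, l' (l A) = A) (e2 : ∀ A, l (l' A) = A) (r : ℤ)
    (hr : ∀ A ∈ M, G2 A + G2 (l A) + G2 (l (l A)) = r) : 3 * ∑ A ∈ M, G2 A = ∑ A ∈ M, r := by
  rw [← Finset.sum_congr rfl hr]
  simp only [Finset.sum_add_distrib]
  rw [reidx M l l' h1 h2 e1 e2 (fun A => G2 (l A)), reidx M l l' h1 h2 e1 e2 G2]; ring

lemma S2_M1 {n X : ℤ} (hn : 0 < n) : 3 * ∑ A ∈ M1 n X, S2 A = ∑ A ∈ M1 n X, 2 := by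
  rw [sum_S2 1 _ M1_uu M1_uv]
  apply sum_G2 M1_l M1_l'
  · intro A; simp [l1, l1']
  · intro A; simp [l1, l1']
  · rintro ⟨a, b, c, d⟩ hA
    apply G2_sum1
    rintro ⟨rfl, rfl⟩
    rw [mem_M1] at hA; have := hA.1; simp at this; omega

lemma S2_M3 {n X : ℤ} (hn : 0 < n) : 3 * ∑ A ∈ M3 n X, S2 A = ∑ A ∈ M3 n X, 4 := by
  rw [sum_S2 3 _ M3_uu M3_uv]
  apply sum_G2 M3_l M3_l'
  · rintro ⟨a, b, c, d⟩; simp only [l3, l3', Prod.mk.injEq]; refine ⟨by ring, by ring, by ring, by ring⟩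
  · rintro ⟨a, b, c, d⟩; simp only [l3, l3', Prod.mk.injEq]; refine ⟨by ring, by ring, by ring, by ring⟩
  · rintro ⟨a, b, c, d⟩ hA
    apply G2_sum3
    rintro ⟨rfl, rfl⟩
    rw [mem_M3] at hA; have := hA.1; simp at this; omega

lemma mul_bds {x y m : ℤ} (hx : 0 < x) (hy : 0 < y) (h : x * y ≤ m) : x ≤ m ∧ y ≤ m := by
  constructor <;> nlinarith

lemma core1 {n X : ℤ} (hn : 0 < n) (hX : 100 * n ≤ X) : ∑ A ∈ M1 n X, RR A - ∑ A ∈ M1 n X, S2 A = 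
    4 * ∑ x ∈ PP 1 n, (x.1 + x.2) + 8 * 1 * ∑ x ∈ PP 1 n with x.1 < x.2, (x.2 - x.1) := by
  apply core one_pos hn _ M1_ng M1_adj M1_JJ
  · intro a b c d h ha hb hc hd
    rw [abs_le] at *
    simp only [mem_M1, C1, bd]; refine ⟨h, ?_⟩; omega
  · intro β γ h1 h2 e
    have := mul_bds h1 h2 e.le
    refine ⟨-X, X - β - γ, by omega, by omega, by omega, ?_⟩
    intro d
    simp only [mem_M1, C1, bd]
    constructor
    · rintro ⟨_, h⟩; omega
    · intro h; refine ⟨by rw [← e]; ring, by omega⟩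
  · intro a d h1 h2 e
    have := mul_bds (x := a) (y := d) (m := n) h1 (by omega) (by linarith)
    refine ⟨-X + a, X - d, by omega, by omega, by omega, ?_⟩
    intro c
    simp only [mem_M1, C1, bd]
    constructor
    · rintro ⟨_, h⟩; omega
    · intro h; refine ⟨by rw [← e]; ring, by omega⟩
  · intro a b c d h; rw [mem_M1] at h; exact h.1

lemma core3 {n Y : ℤ} (hn : 0 < n) (hX : 100 * n ≤ Y) : ∑ A ∈ M3 n (4 * Y), RR A - ∑ A ∈ M3 n (4 * Y), S2 A = 
    4 * ∑ x ∈ PP 1 n, (x.1 + x.2) + 8 * 3 * ∑ x ∈ PP 3 n with x.1 < x.2, (x.2 - x.1) := by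
  apply core three_pos hn _ M3_ng M3_adj M3_JJ
  · intro a b c d h ha hb hc hd
    rw [abs_le] at *
    simp only [mem_M3, C3, bd]; refine ⟨h, ?_⟩; omega
  · intro β γ h1 h2 e
    have := mul_bds h1 h2 e.le
    refine ⟨-Y - (β + γ) / 2, Y - (β + γ + 1) / 2, by omega, by omega, by omega, ?_⟩
    intro d
    simp only [mem_M3, C3, bd]
    constructor
    · rintro ⟨_, h⟩; omega
    · intro h; refine ⟨by rw [← e]; ring, by omega⟩
  · intro a d h1 h2 e
    have := mul_bds (x := a) (y := d) (m := n) h1 (by omega) (by nlinarith)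
    refine ⟨-2 * Y - d + (3 * a + 1) / 2, 2 * Y - 2 * d + (3 * a) / 2, by omega, by omega, by omega, ?_⟩
    intro c
    simp only [mem_M3, C3, bd]
    constructor
    · rintro ⟨_, h⟩; omega
    · intro h; refine ⟨by rw [← e]; ring, by omega⟩
  · intro a b c d h; rw [mem_M3] at h; exact h.1



end

section


lemma sg3 (x : ℤ) : sg (3 * x) = sg x := by rw [sg_mul, sg_pos (show (0:ℤ) < 3 by norm_num), one_mul]

lemma tau_as {p h l : ℤ} (s e1 e2 : ℤ) (hs : p + h + l = s) (h1 : 2 * l + h = e1) (h2 : 2 * p + h = e2) :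
    tau (p, h, l) = -2 - (sg p + sg l) * sg h + (sg l + sg s) * sg e1 + (sg p + sg s) * sg e2 := by
  subst hs h1 h2; rfl

lemma RR_as (A : Q4) (b c e : ℤ) (hb : A.2.1 = b) (hc : A.2.2.1 = c) (he : A.1 - A.2.2.2 = e) :
    RR A = (sg c - sg b) * sg e := by
  subst hb hc he; rfl

def T1 (A : Q4) : ℤ := -2 + RR A + RR (uu 1 A) + RR (uu 1 (uu 1 A))
def T3 (A : Q4) : ℤ := -8 + RR A + RR (uu 3 A) + RR (uu 3 (uu 3 A)) + RR (uu 3 (uu 3 (uu 3 A)))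
  + RR (uu 3 (uu 3 (uu 3 (uu 3 A)))) + RR (uu 3 (uu 3 (uu 3 (uu 3 (uu 3 A)))))

lemma tau_T1 (a b c d : ℤ) : tau (c, d - a, -b) = T1 (a, b, c, d) := by
  rw [T1, tau_as (c + (d - a) + -b) _ _ rfl rfl rfl,
    RR_as (a,b,c,d) b c (-(d-a)) rfl rfl (by simp),
    RR_as (uu 1 (a,b,c,d)) (-(c + (d - a) + -b)) (-b) (2 * -b + (d - a)) (by simp only [uu]; ring) (by simp only [uu]) (by simp only [uu]; ring),
    RR_as (uu 1 (uu 1 (a,b,c,d))) (-c) (c + (d - a) + -b) (2 * c + (d - a)) (by simp only [uu]; ring) (by simp only [uu]; ring) (by simp only [uu]; ring)]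
  simp only [sg_neg]; ring

lemma tau_T3 (a b c d p h l : ℤ) (hp : p = c) (hh : h = d - a) (hl : l = -b) :
    tau (3 * p, 3 * h, l) + tau (3*p+3*h+l, 3*h+2*l, l) + tau (3*p+6*h+4*l, 3*h+4*l, l)
     + tau (3*p+6*h+4*l, 3*(-(4*p+7*h+4*l)), 3*(4*p+6*h+3*l)) = T3 (a, b, c, d) := by
  rw [T3, tau_as (p := 3*p) (3*p+3*h+l) (3*h+2*l) (3*(2*p+h)) (by ring) (by ring) (by ring),
    tau_as (p := 3*p+3*h+l) (3*p+6*h+4*l) (3*h+4*l) (6*p+9*h+4*l) (by ring) (by ring) (by ring),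
    tau_as (h := 3*h+4*l) (3*(p+3*h+3*l)) (3*(h+2*l)) (3*(2*p+5*h+4*l)) (by ring) (by ring) (by ring),
    tau_as (l := 3*(4*p+6*h+3*l)) (3*p+3*h+l) (3*(4*p+5*h+2*l)) (-(6*p+9*h+4*l)) (by ring) (by ring) (by ring),
    RR_as (a,b,c,d) (-l) p (-h) (by simp only [hl]; ring) hp.symm (by simp only [hh]; ring),
    RR_as (uu 3 (a,b,c,d)) (-(p+3*h+3*l)) l (h+2*l) (by simp only [uu, hp, hh, hl]; ring) (by simp only [uu, hl])
      (by simp only [uu, hh, hl]; ring),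
    RR_as (uu 3 (uu 3 (a,b,c,d))) (-(3*p+6*h+4*l)) (p+3*h+3*l) (2*p+5*h+4*l) (by simp only [uu, hp, hh, hl]; ring)
      (by simp only [uu, hp, hh, hl]; ring) (by simp only [uu, hp, hh, hl]; ring),
    RR_as (uu 3 (uu 3 (uu 3 (a,b,c,d)))) (-(4*p+6*h+3*l)) (3*p+6*h+4*l) (4*p+7*h+4*l) (by simp only [uu, hp, hh, hl]; ring)
      (by simp only [uu, hp, hh, hl]; ring) (by simp only [uu, hp, hh, hl]; ring),
    RR_as (uu 3 (uu 3 (uu 3 (uu 3 (a,b,c,d))))) (-(3*p+3*h+l)) (4*p+6*h+3*l) (4*p+5*h+2*l) (by simp only [uu, hp, hh, hl]; ring)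
      (by simp only [uu, hp, hh, hl]; ring) (by simp only [uu, hp, hh, hl]; ring),
    RR_as (uu 3 (uu 3 (uu 3 (uu 3 (uu 3 (a,b,c,d)))))) (-p) (3*p+3*h+l) (2*p+h) (by simp only [uu, hp, hh, hl]; ring)
      (by simp only [uu, hp, hh, hl]; ring) (by simp only [uu, hp, hh, hl]; ring)]
  simp only [sg_neg, sg3]; ring

lemma sum_T1 {n X : ℤ} (hn : 0 < n) (hX : 100 * n ≤ X) : ∑ A ∈ M1 n X, T1 A =
    12 * ∑ x ∈ PP 1 n, (x.1 + x.2) + 24 * ∑ x ∈ PP 1 n with x.1 < x.2, (x.2 - x.1) := by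
  have e : ∀ F : Q4 → ℤ, ∑ A ∈ M1 n X, F (uu 1 A) = ∑ A ∈ M1 n X, F A := reidx _ _ _ M1_uu M1_uv (uvu 1) (uuv 1)
  have h := core1 hn hX
  have h2 := S2_M1 (n := n) (X := X) hn
  simp only [T1, Finset.sum_add_distrib] at h ⊢
  rw [e (fun A => RR (uu 1 A)), e RR, Finset.sum_const] 
  rw [Finset.sum_const] at h2
  simp only [nsmul_eq_mul] at h2 ⊢
  linarith

lemma sum_T3 {n Y : ℤ} (hn : 0 < n) (hX : 100 * n ≤ Y) : ∑ A ∈ M3 n (4 * Y), T3 A =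
    24 * ∑ x ∈ PP 1 n, (x.1 + x.2) + 144 * ∑ x ∈ PP 3 n with x.1 < x.2, (x.2 - x.1) := by
  have e : ∀ F : Q4 → ℤ, ∑ A ∈ M3 n (4 * Y), F (uu 3 A) = ∑ A ∈ M3 n (4 * Y), F A := reidx _ _ _ M3_uu M3_uv (uvu 3) (uuv 3)
  have h := core3 hn hX
  have h2 := S2_M3 (n := n) (X := 4 * Y) hn
  simp only [T3, Finset.sum_add_distrib] at h ⊢
  rw [e (fun A => RR (uu 3 (uu 3 (uu 3 (uu 3 A))))), e (fun A => RR (uu 3 (uu 3 (uu 3 A)))), 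
    e (fun A => RR (uu 3 (uu 3 A))), e (fun A => RR (uu 3 A)), e RR, Finset.sum_const] 
  rw [Finset.sum_const] at h2
  simp only [nsmul_eq_mul] at h2 ⊢
  linarith



end

section


lemma bridge {M S : Finset Q4} {F G : Q4 → ℤ} (Φ : Q4 → Q4) (hFG : ∀ A ∈ M, F A = G (Φ A))
    (inj : ∀ A B, Φ A = Φ B → A = B) (h1 : ∀ A ∈ M, G (Φ A) ≠ 0 → Φ A ∈ S)
    (h2 : ∀ x ∈ S, G x ≠ 0 → ∃ A ∈ M, Φ A = x) : ∑ A ∈ M, F A = ∑ x ∈ S, G x := by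
  apply Finset.sum_bij_ne_zero (fun A _ _ => Φ A)
  · intro A hA h; rw [hFG A hA] at h; exact h1 A hA h
  · intro A _ _ B _ _ h; exact inj A B h
  · intro x hx h
    obtain ⟨A, hA, e⟩ := h2 x hx h
    exact ⟨A, hA, by rw [hFG A hA, e]; exact h, e⟩
  · intro A hA _; exact hFG A hA

noncomputable def SX (n : ℤ) : Finset Q4 := (bx (12 * n)).filter (fun x => formDisc x.2 = -(12 * n - 9 * x.1^2))

lemma mem_bx {X : ℤ} (a b c d : ℤ) : (a,b,c,d) ∈ bx X ↔ bd X a ∧ bd X b ∧ bd X c ∧ bd X d := by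
  simp only [bx, Finset.mem_product, Finset.mem_Icc, bd]

lemma mem_SX {n : ℤ} (t p h l : ℤ) (hd : formDisc (p,h,l) = -(12 * n - 9 * t^2)) (ht : tau (p,h,l) ≠ 0) :
    (t,p,h,l) ∈ SX n := by
  have := tau_bound ht hd
  simp only [abs_le] at this
  rw [SX, Finset.mem_filter, mem_bx]
  refine ⟨?_, hd⟩
  simp only [bd]
  have h1 : t ≤ t^2 := by nlinarith [Int.le_self_sq t]
  have h2 : -t ≤ t^2 := by nlinarith [Int.le_self_sq (-t)]
  have h3 : 0 ≤ t^2 := sq_nonneg t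
  omega

lemma of_SX {n : ℤ} {t p h l : ℤ} (hx : (t,p,h,l) ∈ SX n) : h^2 - 4 * p * l = -(12 * n - 9 * t^2) ∧ 
    bd (12*n) t ∧ bd (12*n) p ∧ bd (12*n) h ∧ bd (12*n) l := by
  rw [SX, Finset.mem_filter, mem_bx] at hx
  exact ⟨hx.2, hx.1⟩

lemma par {h t q : ℤ} (e : h^2 = t^2 + 4 * q) : (t - h) % 2 = 0 := by
  have : (h^2) % 2 = (t^2) % 2 := by omega
  rw [pow_two, pow_two, Int.mul_emod, Int.mul_emod t] at this
  rcases Int.emod_two_eq_zero_or_one h with h1 | h1 <;> rcases Int.emod_two_eq_zero_or_one t with h2 | h2 <;>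
  rw [h1, h2] at this <;> omega

lemma lift3 {t p h l n : ℤ} (e : 9 * h^2 - 12 * p * l = -(12 * n - 9 * t^2)) :
    ∃ a b c d, 3 * (a * d) - b * c = n ∧ c = p ∧ d - a = h ∧ -b = l ∧ a + d = t := by
  have e0 : (3 * h)^2 = (3*t)^2 + 4 * (3 * p * l - 3 * n) := by linarith
  have := par e0
  refine ⟨(t-h)/2, -l, p, (t+h)/2, ?_, rfl, by omega, by ring, by omega⟩
  obtain ⟨a, ha⟩ : ∃ a, t = h + 2 * a := ⟨(t-h)/2, by omega⟩
  subst ha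
  rw [show (h + 2*a - h)/2 = a by omega, show (h + 2*a+h)/2 = h + a by omega]
  nlinarith

lemma lift1 {t p h l n : ℤ} (e : h^2 - 4 * p * l = -(4 * n - t^2)) :
    ∃ a b c d, 1 * (a * d) - b * c = n ∧ c = p ∧ d - a = h ∧ -b = l ∧ a + d = t := by
  have e0 : h^2 = t^2 + 4 * (p * l - n) := by linarith
  have := par e0
  refine ⟨(t-h)/2, -l, p, (t+h)/2, ?_, rfl, by omega, by ring, by omega⟩
  obtain ⟨a, ha⟩ : ∃ a, t = h + 2 * a := ⟨(t-h)/2, by omega⟩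
  subst ha
  rw [show (h + 2*a - h)/2 = a by omega, show (h + 2*a+h)/2 = h + a by omega]
  nlinarith

def ga1 (p h l : ℤ) : ℤ × ℤ × ℤ := (3*p, 3*h, l)
def ga2 (p h l : ℤ) : ℤ × ℤ × ℤ := (3*p+3*h+l, 3*h+2*l, l)
def ga3 (p h l : ℤ) : ℤ × ℤ × ℤ := (3*p+6*h+4*l, 3*h+4*l, l)
def ga4 (p h l : ℤ) : ℤ × ℤ × ℤ := (3*p+6*h+4*l, 3*(-(4*p+7*h+4*l)), 3*(4*p+6*h+3*l))

/-- bridge for one of the four types -/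
lemma bridge3 {n Y : ℤ} (ga : ℤ → ℤ → ℤ → ℤ × ℤ × ℤ) (ty : ℤ × ℤ × ℤ → Prop) [DecidablePred ty]
    (hdisc : ∀ p h l, formDisc (ga p h l) = 9*h^2 - 12*p*l)
    (hty : ∀ p h l, ty (ga p h l))
    (hinj : ∀ p h l p' h' l', ga p h l = ga p' h' l' → p = p' ∧ h = h' ∧ l = l')
    (hsur : ∀ p' h' l', ty (p',h',l') → bd (12*n) p' → bd (12*n) h' → bd (12*n) l' →
      ∃ p h l, ga p h l = (p',h',l') ∧ bd (1000*n) p ∧ bd (1000*n) h ∧ bd (1000*n) l) (hY : Y = 100000 * n) :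
    ∑ A ∈ M3 n (4 * Y), tau (ga A.2.2.1 (A.2.2.2 - A.1) (-A.2.1)) = ∑ x ∈ SX n with ty x.2, tau x.2 := by
  apply bridge (G := fun x => tau x.2) (fun A => (A.1 + A.2.2.2, ga A.2.2.1 (A.2.2.2 - A.1) (-A.2.1)))
  · intro A _; rfl
  · rintro ⟨a,b,c,d⟩ ⟨a',b',c',d'⟩ h
    simp only [Prod.mk.injEq] at h
    have := hinj _ _ _ _ _ _ h.2
    simp only [Prod.mk.injEq]; omega
  · rintro ⟨a,b,c,d⟩ hA h
    rw [mem_M3] at hA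
    have e := hA.1
    simp only at h e ⊢
    rw [Finset.mem_filter]
    refine ⟨mem_SX _ _ _ _ ?_ h, hty _ _ _⟩
    show formDisc (ga c (d-a) (-b)) = _
    rw [hdisc, ← e]; ring
  · rintro ⟨t, p', h', l'⟩ hx _
    rw [Finset.mem_filter] at hx
    obtain ⟨hx, hty'⟩ := hx
    obtain ⟨e, b0, b1, b2, b3⟩ := of_SX hx
    obtain ⟨p, h, l, hg, c1, c2, c3⟩ := hsur _ _ _ hty' b1 b2 b3
    have e' : 9*h^2 - 12*p*l = -(12 * n - 9 * t^2) := by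
      rw [← hdisc, hg]; exact e
    obtain ⟨a, b, c, d, h0, h1, h2, h3, h4⟩ := lift3 e'
    refine ⟨(a,b,c,d), ?_, ?_⟩
    · rw [mem_M3]
      refine ⟨h0, ?_⟩
      simp only [bd] at *
      subst hY
      clear e e' h0 hg hsur hinj hdisc hty hx hty'
      omega
    · simp only [h2, h3, h4, ← hg, h1]

lemma S_all {n : ℤ} :
   ∑ A ∈ M3 n (4 * (100000 * n)), T3 A = (∑ x ∈ SX n with (3 ∣ x.2.1 ∧ 3 ∣ x.2.2.1), tau x.2)
    + (∑ x ∈ SX n with (3 ∣ x.2.2.1 + x.2.1 ∧ 3 ∣ x.2.2.2 - x.2.1), tau x.2)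
    + (∑ x ∈ SX n with (3 ∣ x.2.2.1 - x.2.1 ∧ 3 ∣ x.2.2.2 - x.2.1), tau x.2)
    + (∑ x ∈ SX n with (3 ∣ x.2.2.1 ∧ 3 ∣ x.2.2.2), tau x.2) := by
  rw [← bridge3 (n := n) ga1 (fun g => 3 ∣ g.1 ∧ 3 ∣ g.2.1) ?_ ?_ ?_ ?_ rfl, 
    ← bridge3 (n := n) ga2 (fun g => 3 ∣ g.2.1 + g.1 ∧ 3 ∣ g.2.2 - g.1) ?_ ?_ ?_ ?_ rfl, 
    ← bridge3 (n := n) ga3 (fun g => 3 ∣ g.2.1 - g.1 ∧ 3 ∣ g.2.2 - g.1) ?_ ?_ ?_ ?_ rfl, 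
    ← bridge3 (n := n) ga4 (fun g => 3 ∣ g.2.1 ∧ 3 ∣ g.2.2) ?_ ?_ ?_ ?_ rfl]
  · simp only [← Finset.sum_add_distrib]
    apply Finset.sum_congr rfl
    rintro ⟨a,b,c,d⟩ _
    exact (tau_T3 a b c d c (d-a) (-b) rfl rfl rfl).symm
  · intro p h l; simp only [formDisc, ga4]; ring
  · intro p h l; simp only [ga4]; omega
  · intro p h l p' h' l'; simp only [ga4, Prod.mk.injEq]; omega
  · intro p h l ht b1 b2 b3; simp only at ht
    refine ⟨3*p+6*(h/3)+4*(l/3), -4*p-7*(h/3)-4*(l/3), 4*p+6*(h/3)+3*(l/3), ?_⟩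
    simp only [ga4, Prod.mk.injEq, bd] at *; omega
  · intro p h l; simp only [formDisc, ga3]; ring
  · intro p h l; simp only [ga3]; omega
  · intro p h l p' h' l'; simp only [ga3, Prod.mk.injEq]; omega
  · intro p h l ht b1 b2 b3; simp only at ht
    refine ⟨(p-2*h+4*l)/3, (h-4*l)/3, l, ?_⟩
    simp only [ga3, Prod.mk.injEq, bd, and_true, true_and] at *; omega
  · intro p h l; simp only [formDisc, ga2]; ring
  · intro p h l; simp only [ga2]; omega
  · intro p h l p' h' l'; simp only [ga2, Prod.mk.injEq]; omega
  · intro p h l ht b1 b2 b3; simp only at ht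
    refine ⟨(p-h+l)/3, (h-2*l)/3, l, ?_⟩
    simp only [ga2, Prod.mk.injEq, bd, and_true, true_and] at *; omega
  · intro p h l; simp only [formDisc, ga1]; ring
  · intro p h l; simp only [ga1]; omega
  · intro p h l p' h' l'; simp only [ga1, Prod.mk.injEq]; omega
  · intro p h l ht b1 b2 b3; simp only at ht
    refine ⟨p/3, h/3, l, ?_⟩
    simp only [ga1, Prod.mk.injEq, bd, and_true, true_and] at *; omega

lemma types {p h l : ℤ} (e : 3 ∣ h^2 - 4*p*l) (v : ℤ) :
    (if 3 ∣ p ∧ 3 ∣ h then v else 0) + (if 3 ∣ h + p ∧ 3 ∣ l - p then v else 0)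
    + (if 3 ∣ h - p ∧ 3 ∣ l - p then v else 0) + (if 3 ∣ h ∧ 3 ∣ l then v else 0)
    = v + 3 * (if 3 ∣ p ∧ 3 ∣ h ∧ 3 ∣ l then v else 0) := by
  have e1 : (h * h - p * l) % 3 = 0 := by
    have : h * h - p * l = (h^2-4*p*l) + 3 * (p * l) := by ring
    omega
  obtain ⟨p', r, hp, hr⟩ : ∃ p' r, p = 3 * p' + r ∧ (r = 0 ∨ r = 1 ∨ r = 2) := ⟨p/3, p%3, by omega, by omega⟩
  obtain ⟨h', s, hh, hs⟩ : ∃ p' r, h = 3 * p' + r ∧ (r = 0 ∨ r = 1 ∨ r = 2) := ⟨h/3, h%3, by omega, by omega⟩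
  obtain ⟨l', u, hl, hu⟩ : ∃ p' r, l = 3 * p' + r ∧ (r = 0 ∨ r = 1 ∨ r = 2) := ⟨l/3, l%3, by omega, by omega⟩
  have e2 : (s * s - r * u) % 3 = 0 := by
    have : h * h - p * l = s * s - r * u + 3 * (3*h'*h'+2*h'*s - 3*p'*l' - p'*u - r*l') := by rw [hp,hh,hl]; ring
    omega
  clear e e1
  rcases hr with rfl | rfl | rfl <;> rcases hs with rfl | rfl | rfl <;> rcases hu with rfl | rfl | rfl <;>
  norm_num at e2 <;> split_ifs <;> omega

lemma S_tot {n : ℤ} : ∑ A ∈ M3 n (4 * (100000 * n)), T3 A = (∑ x ∈ SX n, tau x.2)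
    + 3 * ∑ x ∈ SX n with (3 ∣ x.2.1 ∧ 3 ∣ x.2.2.1 ∧ 3 ∣ x.2.2.2), tau x.2 := by
  rw [S_all]
  simp only [Finset.sum_filter]
  rw [Finset.mul_sum]
  simp only [← Finset.sum_add_distrib]
  apply Finset.sum_congr rfl
  rintro ⟨t,p,h,l⟩ hx
  apply types
  have := (of_SX hx).1
  rw [this]
  exact ⟨-(4*n-3*t^2), by ring⟩

lemma S_div {m : ℤ} :
    ∑ x ∈ SX (3 * m) with (3 ∣ x.2.1 ∧ 3 ∣ x.2.2.1 ∧ 3 ∣ x.2.2.2), tau x.2 = ∑ A ∈ M1 m (100000 * m), T1 A := by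
  symm
  apply bridge (fun A => (A.1 + A.2.2.2, 3 * A.2.2.1, 3 * (A.2.2.2 - A.1), 3 * (-A.2.1)))
  · rintro ⟨a,b,c,d⟩ _
    rw [← tau_T1]
    simp only
    rw [tau_as (p := 3 * c) (h := 3 * (d - a)) (l := 3 * -b) (3 * (c + (d - a) + -b)) (3 * (2*(-b)+(d-a))) (3 * (2*c+(d-a))) (by ring) (by ring) (by ring)]
    simp only [sg3, tau]
  · rintro ⟨a,b,c,d⟩ ⟨a',b',c',d'⟩ h
    simp only [Prod.mk.injEq] at h ⊢; omega
  · rintro ⟨a,b,c,d⟩ hA h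
    rw [mem_M1] at hA
    have e := hA.1
    simp only at h e ⊢
    rw [Finset.mem_filter]
    refine ⟨mem_SX _ _ _ _ ?_ h, by simp⟩
    simp only [formDisc]
    rw [← e]; ring
  · rintro ⟨t, p', h', l'⟩ hx _
    rw [Finset.mem_filter] at hx
    obtain ⟨hx, hty'⟩ := hx
    obtain ⟨e, b0, b1, b2, b3⟩ := of_SX hx
    obtain ⟨⟨p, hp⟩, ⟨h, hh⟩, ⟨l, hl⟩⟩ := hty'
    simp only at hp hh hl
    have e' : h^2 - 4*p*l = -(4 * m - t^2) := by
      subst hp hh hl; linarith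
    obtain ⟨a, b, c, d, h0, h1, h2, h3, h4⟩ := lift1 e'
    refine ⟨(a,b,c,d), ?_, ?_⟩
    · rw [mem_M1]
      refine ⟨h0, ?_⟩
      simp only [bd] at *
      clear e e' h0 hx
      omega
    · simp only [h2, h3, h4, h1, hp, hh, hl]

lemma S_ndiv {n : ℤ} (hn : ¬ 3 ∣ n) :
    ∑ x ∈ SX n with (3 ∣ x.2.1 ∧ 3 ∣ x.2.2.1 ∧ 3 ∣ x.2.2.2), tau x.2 = 0 := by
  rw [Finset.filter_false_of_mem, Finset.sum_empty]
  rintro ⟨t, p', h', l'⟩ hx ⟨⟨p, hp⟩, ⟨h, hh⟩, ⟨l, hl⟩⟩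
  simp only at hp hh hl
  have e := (of_SX hx).1
  subst hp hh hl
  apply hn
  have : 12 * n = 9 * (t^2 - h^2 + 4 * p * l) := by linarith
  generalize (t^2 - h^2 + 4 * p * l) = z at this
  omega

lemma S_H {n : ℤ} : ((∑ x ∈ SX n, tau x.2 : ℤ) : ℝ) = ∑ t ∈ Finset.Icc (-(12*n)) (12*n), 24 * hurwitzClassNumber (12 * n - 9 * t^2) := by
  have : ∀ t ∈ Finset.Icc (-(12*n)) (12*n), 24 * hurwitzClassNumber (12 * n - 9 * t^2) = 
     ((∑ f ∈ Finset.Icc (-(12*n)) (12*n) ×ˢ Finset.Icc (-(12*n)) (12*n) ×ˢ Finset.Icc (-(12*n)) (12*n) with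
       formDisc f = -(12 * n - 9 * t^2), tau f : ℤ) : ℝ) := by
    intro t _
    symm
    convert sum_tau _ _ _ 
    rintro ⟨p,h,l⟩ h1 h2
    have := mem_SX t p h l h1 h2
    have := (of_SX this).2
    simp only [Finset.mem_product, Finset.mem_Icc]; exact this.2
  rw [Finset.sum_congr rfl this, ← Int.cast_sum]
  congr 1
  rw [SX, Finset.sum_filter, bx, Finset.sum_product]
  apply Finset.sum_congr rfl
  intro t _
  rw [Finset.sum_filter]



end

section


lemma hurwitz_neg {N : ℤ} (hN : N < 0) : hurwitzClassNumber N = 0 := by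
  have := sum_tau N ∅ (by
    rintro ⟨p,h,l⟩ h1 h2
    have := (tau_bound h2 h1).1
    omega)
  simp at this
  exact this

lemma HH_eq (n : ℕ) : HH 0 0 3 (3 * n) =
    ∑ t ∈ Finset.Icc (-(12*(n:ℤ))) (12*(n:ℤ)), hurwitzClassNumber (12 * n - 9 * t^2) := by
  rw [HH]
  rw [finsum_eq_sum_of_support_subset (s := (Finset.Icc (-(12*(n:ℤ))) (12*(n:ℤ))).image (fun t => 3 * t))]
  · rw [Finset.sum_image (by intro a _ b _ h; simpa using h)]
    apply Finset.sum_congr rfl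
    intro t _
    rw [if_pos (by simp)]
    rw [pow_zero, one_mul]
    congr 1
    push_cast; ring
  · intro t ht
    rw [Function.mem_support] at ht
    have h1 : t % ((3:ℕ):ℤ) = 0 % ((3:ℕ):ℤ) := by
      by_contra h; rw [if_neg h] at ht; exact ht rfl
    rw [if_pos h1] at ht
    have h2 : ¬ (4 * ((3 * n : ℕ):ℤ) - t^2 < 0) := by
      intro h; rw [hurwitz_neg h] at ht; simp at ht
    simp only [Finset.coe_image, Set.mem_image, Finset.mem_coe, Finset.mem_Icc]
    have h3 : t ≤ t^2 := by nlinarith [Int.le_self_sq t]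
    have h4 : -t ≤ t^2 := by nlinarith [Int.le_self_sq (-t)]
    push_cast at h1 h2
    refine ⟨t/3, ?_, ?_⟩ <;> omega

lemma PP_fst (n : ℕ) (hn : 0 < n) (F : ℤ → ℤ) : ∑ x ∈ PP 1 (n:ℤ), F x.1 = ∑ d ∈ n.divisors, F (d:ℤ) := by
  symm
  apply Finset.sum_bij (fun (d : ℕ) _ => ((d:ℤ), ((n/d : ℕ):ℤ)))
  · intro d hd
    have h := (Nat.mem_divisors.1 hd).1
    rw [mem_PP one_pos]
    have h1 : d * (n/d) = n := Nat.mul_div_cancel' h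
    have h2 : 0 < d := Nat.pos_of_dvd_of_pos h hn
    have h3 : 0 < n/d := by
      rcases Nat.eq_zero_or_pos (n/d) with h0 | h0
      · rw [h0] at h1; omega
      · exact h0
    dsimp only
    refine ⟨by exact_mod_cast h2, by exact_mod_cast h3, ?_⟩
    rw [one_mul]; exact_mod_cast h1
  · intro a _ b _ h
    simp only [Prod.mk.injEq] at h
    exact_mod_cast h.1
  · rintro ⟨x, y⟩ hx
    rw [mem_PP one_pos] at hx
    obtain ⟨h1, h2, h3⟩ := hx
    simp only [one_mul] at h1 h2 h3
    lift x to ℕ using h1.le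
    lift y to ℕ using h2.le
    have h4 : x * y = n := by exact_mod_cast h3
    have h1' : 0 < x := by exact_mod_cast h1
    refine ⟨x, Nat.mem_divisors.2 ⟨⟨y, h4.symm⟩, hn.ne'⟩, ?_⟩
    rw [← h4, Nat.mul_div_cancel_left _ h1']
  · intros; rfl

lemma PP_swap (n : ℤ) (F : ℤ → ℤ → ℤ) : ∑ x ∈ PP 1 n, F x.1 x.2 = ∑ x ∈ PP 1 n, F x.2 x.1 := by
  apply Finset.sum_bij (fun x _ => (x.2, x.1))
  · intro x hx
    rw [mem_PP one_pos] at hx ⊢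
    exact ⟨hx.2.1, hx.1, by rw [← hx.2.2]; ring⟩
  · rintro ⟨a,b⟩ _ ⟨c,d⟩ _ h; simp only [Prod.mk.injEq] at h ⊢; exact ⟨h.2, h.1⟩
  · rintro ⟨a,b⟩ hx
    rw [mem_PP one_pos] at hx
    refine ⟨(b,a), ?_, rfl⟩
    rw [mem_PP one_pos]
    exact ⟨hx.2.1, hx.1, by rw [← hx.2.2]; ring⟩
  · intros; rfl

lemma PP_sum (n : ℕ) (hn : 0 < n) : ∑ x ∈ PP 1 (n:ℤ), (x.1 + x.2) = 2 * ∑ d ∈ n.divisors, (d:ℤ) := by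
  rw [Finset.sum_add_distrib, PP_swap n (fun _ y => y), PP_fst n hn (fun x => x)]; ring

lemma PP_diff (m : ℕ) (hm : 0 < m) : ∑ x ∈ PP 1 (m:ℤ) with x.1 < x.2, (x.2 - x.1) =
    ∑ d ∈ m.divisors, (d:ℤ) - ∑ d ∈ m.divisors, (if d^2 = m then (d:ℤ) else 0)
     - 2 * ∑ d ∈ m.divisors with d^2 < m, (d:ℤ) := by
  have e1 : ∑ x ∈ PP 1 (m:ℤ) with x.1 < x.2, (x.2 - x.1) = ∑ x ∈ PP 1 (m:ℤ), (if x.1 < x.2 then x.2 else 0)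
      - ∑ x ∈ PP 1 (m:ℤ), (if x.1 < x.2 then x.1 else 0) := by
    rw [Finset.sum_filter, ← Finset.sum_sub_distrib]
    apply Finset.sum_congr rfl; intro x _; split_ifs <;> ring
  rw [e1, PP_swap m (fun x y => if x < y then y else 0), ← PP_fst m hm (fun x => x), Finset.sum_filter]
  have e2 : ∑ d ∈ m.divisors, (if d^2 = m then (d:ℤ) else 0) = ∑ d ∈ m.divisors, (if (d:ℤ)^2 = m then (d:ℤ) else 0) := by
    apply Finset.sum_congr rfl; intro x _; norm_cast
  have e3 : ∑ d ∈ m.divisors, (if d^2 < m then (d:ℤ) else 0) = ∑ d ∈ m.divisors, (if (d:ℤ)^2 < m then (d:ℤ) else 0) := by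
    apply Finset.sum_congr rfl; intro x _; norm_cast
  rw [e2, e3, ← PP_fst m hm (fun d => if d^2 = m then d else 0), ← PP_fst m hm (fun d => if d^2 < m then d else 0)]
  rw [Finset.mul_sum]
  simp only [← Finset.sum_sub_distrib]
  apply Finset.sum_congr rfl
  rintro ⟨x,y⟩ hx
  rw [mem_PP one_pos] at hx
  obtain ⟨h1, h2, h3⟩ := hx
  simp only [one_mul] at h1 h2 h3 ⊢
  rw [← h3]
  have i1 : x^2 = x * y ↔ x = y := by
    rw [pow_two]; exact mul_right_inj' h1.ne'
  have i2 : x^2 < x * y ↔ x < y := by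
    rw [pow_two]; exact mul_lt_mul_iff_right₀ h1
  simp only [i1, i2]
  split_ifs <;> omega

lemma PP3 (m : ℤ) : PP 3 (3 * m) = PP 1 m := by
  ext x
  rw [mem_PP one_pos, mem_PP (by norm_num)]
  constructor <;> rintro ⟨h1, h2, h3⟩ <;> exact ⟨h1, h2, by linarith⟩

lemma PP3' (n : ℤ) (h : ¬ 3 ∣ n) : PP 3 n = ∅ := by
  apply Finset.eq_empty_of_forall_notMem
  intro x hx
  rw [mem_PP (by norm_num)] at hx
  exact h ⟨_, hx.2.2.symm⟩

lemma HH_main (n : ℕ) (hn : 0 < n) : 24 * HH 0 0 3 (3 * n) + 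
    3 * ((∑ x ∈ SX n with (3 ∣ x.2.1 ∧ 3 ∣ x.2.2.1 ∧ 3 ∣ x.2.2.2), tau x.2 : ℤ) : ℝ) = 
    ((48 * ∑ d ∈ n.divisors, (d:ℤ) + 144 * ∑ x ∈ PP 3 n with x.1 < x.2, (x.2 - x.1) : ℤ) : ℝ) := by
  have hn' : (0:ℤ) < n := by exact_mod_cast hn
  have h1 := S_tot (n := (n:ℤ))
  rw [sum_T3 hn' (by linarith), PP_sum n hn] at h1
  have h2 := S_H (n := (n:ℤ))
  rw [← Finset.mul_sum, ← HH_eq] at h2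
  rw [← h2]
  have h3 := congrArg (fun z : ℤ => (z:ℝ)) h1
  push_cast at h3 ⊢
  linarith

lemma sq3 (n : ℕ) (h : IsSquare (12 * n)) : ∃ f, n = 3 * f^2 := by
  obtain ⟨s, hs⟩ := h
  have h2 : 2 ∣ s := by
    have : 2 ∣ s * s := ⟨6 * n, by omega⟩
    rcases (Nat.prime_two.dvd_mul).1 this with h | h <;> exact h
  have h3 : 3 ∣ s := by
    have : 3 ∣ s * s := ⟨4 * n, by omega⟩
    rcases (Nat.prime_three.dvd_mul).1 this with h | h <;> exact h
  obtain ⟨f, hf⟩ : 6 ∣ s := by omega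
  subst hf
  exact ⟨f, by nlinarith⟩

theorem class_number_sum_m_zero_three_dvd (n : ℕ) (hn : 0 < n) :
    HH 0 0 3 (3 * n) =
      2 * (∑ d ∈ n.divisors, (d : ℝ))
      - 6 * (if 3 ∣ n then (1 : ℝ) else 0) *
          (∑ d ∈ (n / 3).divisors.filter (fun d => d ^ 2 < n / 3), (d : ℝ))
      - (if IsSquare (12 * n) then (1 : ℝ) else 0) * Real.sqrt (3 * n) := by
  have hmain := HH_main n hn
  by_cases h3 : 3 ∣ n
  · obtain ⟨m, rfl⟩ := h3
    have hm : 0 < m := by omega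
    rw [show ((3 * m : ℕ) : ℤ) = 3 * (m:ℤ) by push_cast; ring, S_div, PP3, 
      sum_T1 (by exact_mod_cast hm) (by omega), PP_diff m hm, PP_sum m hm] at hmain
    rw [if_pos (Dvd.intro m rfl), Nat.mul_div_cancel_left m (by norm_num)]
    have hE : 3 * ∑ d ∈ m.divisors, (if d^2 = m then (d:ℝ) else 0) =
        (if IsSquare (12 * (3 * m)) then (1 : ℝ) else 0) * Real.sqrt (3 * (3 * m : ℕ)) := by
      split_ifs with hs
      · obtain ⟨f, hf⟩ := sq3 _ hs
        have hf : m = f^2 := by omega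
        subst hf
        have hi : ∀ d : ℕ, d^2 = f^2 ↔ f = d := fun d => by
          rw [Nat.pow_left_inj (by norm_num)]; exact eq_comm
        simp only [hi]
        rw [Finset.sum_ite_eq, if_pos (Nat.mem_divisors.2 ⟨Dvd.intro_left f (by ring), hm.ne'⟩)]
        rw [show (3 * ((3 * f^2 : ℕ):ℝ)) = (3 * (f:ℝ))^2 by push_cast; ring, Real.sqrt_sq (by positivity)]
        ring
      · rw [zero_mul, Finset.sum_eq_zero, mul_zero]
        intro d _
        rw [if_neg]
        rintro rfl
        exact hs ⟨6 * d, by ring⟩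
    rw [← hE]
    push_cast at hmain ⊢
    linarith
  · rw [S_ndiv (by omega), PP3' _ (by omega)] at hmain
    rw [if_neg h3, if_neg (by intro h; obtain ⟨f, hf⟩ := sq3 n h; exact h3 ⟨_, hf⟩)]
    simp at hmain
    linarith



end

end HurwitzPaper
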